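/- (Reduction of recursive to primitive recursive local codes.) There exists a primitive recursive function f : ℕ → ℕ such that: (i) for every a, a ∈ C_rec if and only if f(a) ∈ C_prec; (ii) for every a, a ∈ C_rec^- if and only if f(a) ∈ C_prec^-; (iii) if a ∈ C_rec then End(a) = End(f(a)). -/

import Mathlib

namespace Shoen

/-- Kleene application: value of the `e`-th partial recursive function at `n`,
in the standard numbering via `Nat.Partrec.Code`. -/
def peval (e n : ℕ) : Part ℕ := (Denumerable.ofNat Nat.Partrec.Code e).eval n

/-- `e` is an index of a (total) primitive recursive function. -/
def PrimIndex (e : ℕ) : Prop := ∃ f : ℕ → ℕ, Nat.Primrec f ∧ ∀ n, peval e n = Part.some (f n)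

/-- Kleene's relation `<_O`. -/
inductive KLt : ℕ → ℕ → Prop
  | base : KLt 1 2
  | step {a b : ℕ} : KLt a b → KLt b (2 ^ b)
  | lim {e : ℕ} (h : ∀ n, (peval e n).Dom)
      (hm : ∀ n, KLt ((peval e n).get (h n)) ((peval e (n + 1)).get (h (n + 1))))
      (n : ℕ) : KLt ((peval e n).get (h n)) (3 * 5 ^ e)
  | trans {a b c : ℕ} : KLt a b → KLt b c → KLt a c

/-- Kleene's `O`. -/
def KO (a : ℕ) : Prop := KLt a (2 ^ a)

/-- The auxiliary relation `<'_O`. -/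
inductive KLt' : ℕ → ℕ → Prop
  | base : KLt' 1 2
  | step {a b : ℕ} : KLt' a b → KLt' b (2 ^ b)
  | lim {e n x : ℕ} : x ∈ peval e n → KLt' x (3 * 5 ^ e)
  | trans {a b c : ℕ} : KLt' a b → KLt' b c → KLt' a c

/-- The inductive characterization `O'` of Kleene's `O`. -/
inductive KO' : ℕ → Prop
  | one : KO' 1
  | step {a : ℕ} : KO' a → KO' (2 ^ a)
  | lim {e : ℕ} (h : ∀ n, (peval e n).Dom)
      (hm : ∀ n, KLt' ((peval e n).get (h n)) ((peval e (n + 1)).get (h (n + 1)))) :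
      KO' (3 * 5 ^ e)



/-! ### Syntax of first order arithmetic (negation normal form) -/

/-- Terms of the language `0,1,+,×,=`, with de Bruijn variables. -/
inductive Trm : Type
  | var : ℕ → Trm
  | zero : Trm
  | one : Trm
  | add : Trm → Trm → Trm
  | mul : Trm → Trm → Trm
deriving DecidableEq

/-- Formulas in negation normal form: literals (atomic and negated atomic
formulas) combined by `∧, ∨, ∀, ∃` (de Bruijn binders). -/
inductive Fml : Type
  | eq : Trm → Trm → Fml
  | ne : Trm → Trm → Fml
  | and : Fml → Fml → Fml
  | or : Fml → Fml → Fml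
  | all : Fml → Fml
  | ex : Fml → Fml
deriving DecidableEq

/-- All free variables of a term are `< k`. -/
def Trm.cu : Trm → ℕ → Bool
  | .var i, k => decide (i < k)
  | .zero, _ => true
  | .one, _ => true
  | .add s t, k => s.cu k && t.cu k
  | .mul s t, k => s.cu k && t.cu k

/-- All free variables of a formula are `< k`. -/
def Fml.cu : Fml → ℕ → Bool
  | .eq s t, k => s.cu k && t.cu k
  | .ne s t, k => s.cu k && t.cu k
  | .and A B, k => A.cu k && B.cu k
  | .or A B, k => A.cu k && B.cu k
  | .all A, k => A.cu (k + 1)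
  | .ex A, k => A.cu (k + 1)

/-- A sentence is a closed formula. -/
abbrev Sentence : Type := { A : Fml // A.cu 0 = true }

/-- Value of a term under an environment. -/
def Trm.val (ρ : ℕ → ℕ) : Trm → ℕ
  | .var i => ρ i
  | .zero => 0
  | .one => 1
  | .add s t => s.val ρ + t.val ρ
  | .mul s t => s.val ρ * t.val ρ

/-- Extend an environment by a value for variable `0`. -/
def consEnv (n : ℕ) (ρ : ℕ → ℕ) : ℕ → ℕ
  | 0 => n
  | k + 1 => ρ k

/-- Satisfaction in the standard model `ℕ`. -/
def Fml.Sat (ρ : ℕ → ℕ) : Fml → Prop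
  | .eq s t => s.val ρ = t.val ρ
  | .ne s t => s.val ρ ≠ t.val ρ
  | .and A B => A.Sat ρ ∧ B.Sat ρ
  | .or A B => A.Sat ρ ∨ B.Sat ρ
  | .all A => ∀ n : ℕ, A.Sat (consEnv n ρ)
  | .ex A => ∃ n : ℕ, A.Sat (consEnv n ρ)

/-- Truth of a sentence in the standard model. -/
def sentTrue (A : Sentence) : Prop := A.1.Sat (fun _ => 0)

/-- Substitution of a closed term `t` for variable `k` in a term. -/
def Trm.sub (t : Trm) (k : ℕ) : Trm → Trm
  | .var i => if i = k then t else if k < i then .var (i - 1) else .var i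
  | .zero => .zero
  | .one => .one
  | .add s u => .add (Trm.sub t k s) (Trm.sub t k u)
  | .mul s u => .mul (Trm.sub t k s) (Trm.sub t k u)

/-- Substitution of a closed term `t` for variable `k` in a formula. -/
def Fml.sub (t : Trm) : Fml → ℕ → Fml
  | .eq s u, k => .eq (Trm.sub t k s) (Trm.sub t k u)
  | .ne s u, k => .ne (Trm.sub t k s) (Trm.sub t k u)
  | .and A B, k => .and (A.sub t k) (B.sub t k)
  | .or A B, k => .or (A.sub t k) (B.sub t k)
  | .all A, k => .all (A.sub t (k + 1))
  | .ex A, k => .ex (A.sub t (k + 1))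

/-- The numeral `n̄`. -/
def numeral : ℕ → Trm
  | 0 => .zero
  | n + 1 => .add (numeral n) .one

theorem Trm.cu_mono : ∀ (t : Trm) {j k : ℕ}, j ≤ k → t.cu j = true → t.cu k = true := by
  intro t
  induction t with
  | var i =>
    intro j k h ht
    simp only [Trm.cu, decide_eq_true_eq] at *
    omega
  | zero => intros; rfl
  | one => intros; rfl
  | add s u ihs ihu =>
    intro j k h ht
    simp only [Trm.cu, Bool.and_eq_true] at *
    exact ⟨ihs h ht.1, ihu h ht.2⟩
  | mul s u ihs ihu =>
    intro j k h ht
    simp only [Trm.cu, Bool.and_eq_true] at *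
    exact ⟨ihs h ht.1, ihu h ht.2⟩

theorem Trm.cu_sub : ∀ (s : Trm) {k : ℕ} {t : Trm},
    t.cu 0 = true → s.cu (k + 1) = true → (Trm.sub t k s).cu k = true := by
  intro s
  induction s with
  | var i =>
    intro k t ht hs
    simp only [Trm.cu, decide_eq_true_eq] at hs
    simp only [Trm.sub]
    by_cases h : i = k
    · rw [if_pos h]
      exact Trm.cu_mono t (Nat.zero_le k) ht
    · have h2 : ¬ k < i := by omega
      rw [if_neg h, if_neg h2]
      simp only [Trm.cu, decide_eq_true_eq]
      omega
  | zero => intros; rfl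
  | one => intros; rfl
  | add s u ihs ihu =>
    intro k t ht hs
    simp only [Trm.cu, Bool.and_eq_true] at hs
    simp only [Trm.sub, Trm.cu, Bool.and_eq_true]
    exact ⟨ihs ht hs.1, ihu ht hs.2⟩
  | mul s u ihs ihu =>
    intro k t ht hs
    simp only [Trm.cu, Bool.and_eq_true] at hs
    simp only [Trm.sub, Trm.cu, Bool.and_eq_true]
    exact ⟨ihs ht hs.1, ihu ht hs.2⟩

theorem Fml.cu_sub : ∀ (A : Fml) {k : ℕ} {t : Trm},
    t.cu 0 = true → A.cu (k + 1) = true → (A.sub t k).cu k = true := by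
  intro A
  induction A with
  | eq s u =>
    intro k t ht hA
    simp only [Fml.cu, Bool.and_eq_true] at hA
    simp only [Fml.sub, Fml.cu, Bool.and_eq_true]
    exact ⟨Trm.cu_sub s ht hA.1, Trm.cu_sub u ht hA.2⟩
  | ne s u =>
    intro k t ht hA
    simp only [Fml.cu, Bool.and_eq_true] at hA
    simp only [Fml.sub, Fml.cu, Bool.and_eq_true]
    exact ⟨Trm.cu_sub s ht hA.1, Trm.cu_sub u ht hA.2⟩
  | and A B ihA ihB =>
    intro k t ht h
    simp only [Fml.cu, Bool.and_eq_true] at h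
    simp only [Fml.sub, Fml.cu, Bool.and_eq_true]
    exact ⟨ihA ht h.1, ihB ht h.2⟩
  | or A B ihA ihB =>
    intro k t ht h
    simp only [Fml.cu, Bool.and_eq_true] at h
    simp only [Fml.sub, Fml.cu, Bool.and_eq_true]
    exact ⟨ihA ht h.1, ihB ht h.2⟩
  | all A ihA =>
    intro k t ht h
    simp only [Fml.cu] at h
    simp only [Fml.sub, Fml.cu]
    exact ihA ht h
  | ex A ihA =>
    intro k t ht h
    simp only [Fml.cu] at h
    simp only [Fml.sub, Fml.cu]
    exact ihA ht h

theorem numeral_cu : ∀ n : ℕ, (numeral n).cu 0 = true := by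
  intro n
  induction n with
  | zero => rfl
  | succ n ih => simp [numeral, Trm.cu, ih]

/-- Negation (de Morgan dual) of a formula in negation normal form. -/
def Fml.neg : Fml → Fml
  | .eq s t => .ne s t
  | .ne s t => .eq s t
  | .and A B => .or A.neg B.neg
  | .or A B => .and A.neg B.neg
  | .all A => .ex A.neg
  | .ex A => .all A.neg

theorem Fml.cu_neg : ∀ (A : Fml) {k : ℕ}, A.cu k = true → A.neg.cu k = true := by
  intro A
  induction A with
  | eq s u => intro k h; simpa [Fml.cu, Fml.neg] using h
  | ne s u => intro k h; simpa [Fml.cu, Fml.neg] using h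
  | and A B ihA ihB =>
    intro k h
    simp only [Fml.cu, Bool.and_eq_true] at h
    simp only [Fml.neg, Fml.cu, Bool.and_eq_true]
    exact ⟨ihA h.1, ihB h.2⟩
  | or A B ihA ihB =>
    intro k h
    simp only [Fml.cu, Bool.and_eq_true] at h
    simp only [Fml.neg, Fml.cu, Bool.and_eq_true]
    exact ⟨ihA h.1, ihB h.2⟩
  | all A ihA =>
    intro k h
    simp only [Fml.cu] at h
    simp only [Fml.neg, Fml.cu]
    exact ihA h
  | ex A ihA =>
    intro k h
    simp only [Fml.cu] at h
    simp only [Fml.neg, Fml.cu]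
    exact ihA h

/-- Conjunction of sentences. -/
def sAnd (A B : Sentence) : Sentence :=
  ⟨.and A.1 B.1, by simp [Fml.cu, A.2, B.2]⟩

/-- Disjunction of sentences. -/
def sOr (A B : Sentence) : Sentence :=
  ⟨.or A.1 B.1, by simp [Fml.cu, A.2, B.2]⟩

/-- Negation of a sentence. -/
def sNeg (A : Sentence) : Sentence := ⟨A.1.neg, Fml.cu_neg A.1 A.2⟩

/-- The sentence `∀x A(x)`, for `A` with (at most) one free variable. -/
def sAll (A : Fml) (h : A.cu 1 = true) : Sentence := ⟨.all A, by simpa [Fml.cu] using h⟩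

/-- The sentence `∃x A(x)`, for `A` with (at most) one free variable. -/
def sEx (A : Fml) (h : A.cu 1 = true) : Sentence := ⟨.ex A, by simpa [Fml.cu] using h⟩

/-- The instance `A(n̄)` of a formula `A` with one free variable. -/
def sInst (A : Fml) (h : A.cu 1 = true) (n : ℕ) : Sentence :=
  ⟨A.sub (numeral n) 0, Fml.cu_sub A (numeral_cu n) h⟩

/-- Literals: atomic and negated atomic formulas. -/
def Fml.isLiteral : Fml → Bool
  | .eq _ _ => true
  | .ne _ _ => true
  | _ => false

/-- Quantifier free formulas. -/
def Fml.qf : Fml → Bool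
  | .eq _ _ => true
  | .ne _ _ => true
  | .and A B => A.qf && B.qf
  | .or A B => A.qf && B.qf
  | .all _ => false
  | .ex _ => false

/-- An axiom is a sequent containing a true closed literal. -/
def IsAxiom (Γ : Finset Sentence) : Prop :=
  ∃ A ∈ Γ, A.1.isLiteral = true ∧ sentTrue A

/-- A sequent is true if some member is true. -/
def SeqTrue (Γ : Finset Sentence) : Prop := ∃ A ∈ Γ, sentTrue A


/-! ### A primitive recursive Gödel numbering of terms, sentences and sequents -/

/-- Gödel number of a term. -/
def Trm.enc : Trm → ℕ
  | .var i => 5 * i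
  | .zero => 1
  | .one => 2
  | .add s t => 5 * Nat.pair s.enc t.enc + 3
  | .mul s t => 5 * Nat.pair s.enc t.enc + 4

/-- Fuelled decoding of terms. -/
def Trm.dec : ℕ → ℕ → Option Trm
  | 0, _ => none
  | fuel + 1, n =>
    if n % 5 = 0 then some (.var (n / 5))
    else if n % 5 = 1 then some .zero
    else if n % 5 = 2 then some .one
    else if n % 5 = 3 then
      match Trm.dec fuel (n / 5).unpair.1, Trm.dec fuel (n / 5).unpair.2 with
      | some s, some t => some (.add s t)
      | _, _ => none
    else
      match Trm.dec fuel (n / 5).unpair.1, Trm.dec fuel (n / 5).unpair.2 with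
      | some s, some t => some (.mul s t)
      | _, _ => none

theorem Trm.dec_enc : ∀ (t : Trm) (fuel : ℕ), t.enc < fuel → Trm.dec fuel t.enc = some t := by
  intro t
  induction t with
  | var i =>
    intro fuel h
    match fuel with
    | f + 1 =>
      have h0 : (5 * i) % 5 = 0 := by omega
      have h1 : (5 * i) / 5 = i := by omega
      simp [Trm.dec, Trm.enc, h0, h1]
  | zero =>
    intro fuel h
    match fuel with
    | f + 1 => simp [Trm.dec, Trm.enc]
  | one =>
    intro fuel h
    match fuel with
    | f + 1 => simp [Trm.dec, Trm.enc]
  | add s u ihs ihu =>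
    intro fuel h
    match fuel with
    | f + 1 =>
      simp only [Trm.enc] at h ⊢
      set p := Nat.pair s.enc u.enc with hp
      have h0 : (5 * p + 3) % 5 = 3 := by omega
      have h1 : (5 * p + 3) / 5 = p := by omega
      have hs : s.enc < f := by
        have := Nat.left_le_pair s.enc u.enc
        omega
      have hu : u.enc < f := by
        have := Nat.right_le_pair s.enc u.enc
        omega
      simp only [Trm.dec, h0, h1]
      rw [hp, Nat.unpair_pair, ihs f hs, ihu f hu]
      simp
  | mul s u ihs ihu =>
    intro fuel h
    match fuel with
    | f + 1 =>
      simp only [Trm.enc] at h ⊢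
      set p := Nat.pair s.enc u.enc with hp
      have h0 : (5 * p + 4) % 5 = 4 := by omega
      have h1 : (5 * p + 4) / 5 = p := by omega
      have hs : s.enc < f := by
        have := Nat.left_le_pair s.enc u.enc
        omega
      have hu : u.enc < f := by
        have := Nat.right_le_pair s.enc u.enc
        omega
      simp only [Trm.dec, h0, h1]
      rw [hp, Nat.unpair_pair, ihs f hs, ihu f hu]
      simp

instance : Encodable Trm :=
  ⟨Trm.enc, fun n => Trm.dec (n + 1) n, fun t => Trm.dec_enc t _ (Nat.lt_succ_self _)⟩

/-- Gödel number of a formula. -/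
def Fml.enc : Fml → ℕ
  | .eq s t => 6 * Nat.pair s.enc t.enc
  | .ne s t => 6 * Nat.pair s.enc t.enc + 1
  | .and A B => 6 * Nat.pair A.enc B.enc + 2
  | .or A B => 6 * Nat.pair A.enc B.enc + 3
  | .all A => 6 * A.enc + 4
  | .ex A => 6 * A.enc + 5

/-- Fuelled decoding of formulas. -/
def Fml.dec : ℕ → ℕ → Option Fml
  | 0, _ => none
  | fuel + 1, n =>
    if n % 6 = 0 then
      match Encodable.decode (α := Trm) (n / 6).unpair.1,
            Encodable.decode (α := Trm) (n / 6).unpair.2 with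
      | some s, some t => some (.eq s t)
      | _, _ => none
    else if n % 6 = 1 then
      match Encodable.decode (α := Trm) (n / 6).unpair.1,
            Encodable.decode (α := Trm) (n / 6).unpair.2 with
      | some s, some t => some (.ne s t)
      | _, _ => none
    else if n % 6 = 2 then
      match Fml.dec fuel (n / 6).unpair.1, Fml.dec fuel (n / 6).unpair.2 with
      | some A, some B => some (.and A B)
      | _, _ => none
    else if n % 6 = 3 then
      match Fml.dec fuel (n / 6).unpair.1, Fml.dec fuel (n / 6).unpair.2 with
      | some A, some B => some (.or A B)
      | _, _ => none
    else if n % 6 = 4 then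
      match Fml.dec fuel (n / 6) with
      | some A => some (.all A)
      | none => none
    else
      match Fml.dec fuel (n / 6) with
      | some A => some (.ex A)
      | none => none

theorem Fml.dec_enc : ∀ (A : Fml) (fuel : ℕ), A.enc < fuel → Fml.dec fuel A.enc = some A := by
  intro A
  induction A with
  | eq s u =>
    intro fuel h
    match fuel with
    | f + 1 =>
      simp only [Fml.enc] at h ⊢
      set p := Nat.pair s.enc u.enc with hp
      have h0 : (6 * p) % 6 = 0 := by omega
      have h1 : (6 * p) / 6 = p := by omega
      have hds : Encodable.decode (α := Trm) s.enc = some s := Encodable.encodek s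
      have hdu : Encodable.decode (α := Trm) u.enc = some u := Encodable.encodek u
      simp only [Fml.dec, h0, h1]
      rw [hp, Nat.unpair_pair, hds, hdu]
      simp
  | ne s u =>
    intro fuel h
    match fuel with
    | f + 1 =>
      simp only [Fml.enc] at h ⊢
      set p := Nat.pair s.enc u.enc with hp
      have h0 : (6 * p + 1) % 6 = 1 := by omega
      have h1 : (6 * p + 1) / 6 = p := by omega
      have hds : Encodable.decode (α := Trm) s.enc = some s := Encodable.encodek s
      have hdu : Encodable.decode (α := Trm) u.enc = some u := Encodable.encodek u
      simp only [Fml.dec, h0, h1]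
      rw [hp, Nat.unpair_pair, hds, hdu]
      simp
  | and A B ihA ihB =>
    intro fuel h
    match fuel with
    | f + 1 =>
      simp only [Fml.enc] at h ⊢
      set p := Nat.pair A.enc B.enc with hp
      have h0 : (6 * p + 2) % 6 = 2 := by omega
      have h1 : (6 * p + 2) / 6 = p := by omega
      have hA : A.enc < f := by
        have := Nat.left_le_pair A.enc B.enc
        omega
      have hB : B.enc < f := by
        have := Nat.right_le_pair A.enc B.enc
        omega
      simp only [Fml.dec, h0, h1]
      rw [hp, Nat.unpair_pair, ihA f hA, ihB f hB]
      simp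
  | or A B ihA ihB =>
    intro fuel h
    match fuel with
    | f + 1 =>
      simp only [Fml.enc] at h ⊢
      set p := Nat.pair A.enc B.enc with hp
      have h0 : (6 * p + 3) % 6 = 3 := by omega
      have h1 : (6 * p + 3) / 6 = p := by omega
      have hA : A.enc < f := by
        have := Nat.left_le_pair A.enc B.enc
        omega
      have hB : B.enc < f := by
        have := Nat.right_le_pair A.enc B.enc
        omega
      simp only [Fml.dec, h0, h1]
      rw [hp, Nat.unpair_pair, ihA f hA, ihB f hB]
      simp
  | all A ihA =>
    intro fuel h
    match fuel with
    | f + 1 =>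
      simp only [Fml.enc] at h ⊢
      have h0 : (6 * A.enc + 4) % 6 = 4 := by omega
      have h1 : (6 * A.enc + 4) / 6 = A.enc := by omega
      have hA : A.enc < f := by omega
      simp [Fml.dec, h0, h1, ihA f hA]
  | ex A ihA =>
    intro fuel h
    match fuel with
    | f + 1 =>
      simp only [Fml.enc] at h ⊢
      have h0 : (6 * A.enc + 5) % 6 = 5 := by omega
      have h1 : (6 * A.enc + 5) / 6 = A.enc := by omega
      have hA : A.enc < f := by omega
      simp [Fml.dec, h0, h1, ihA f hA]

instance : Encodable Fml :=
  ⟨Fml.enc, fun n => Fml.dec (n + 1) n, fun A => Fml.dec_enc A _ (Nat.lt_succ_self _)⟩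

/-- Gödel number of a sentence. -/
def encF (A : Sentence) : ℕ := Encodable.encode A

/-- Gödel number of a sequent (finite set of sentences). -/
def encS (Γ : Finset Sentence) : ℕ := Encodable.encode Γ

/-- Decode a Gödel number into a sentence (with a default value). -/
def decF (n : ℕ) : Sentence := (Encodable.decode (α := Sentence) n).getD ⟨.eq .zero .zero, rfl⟩

/-- Decode a Gödel number into a sequent (with a default value). -/
def decS (n : ℕ) : Finset Sentence := (Encodable.decode (α := Finset Sentence) n).getD ∅

/-! ### Tupling of natural numbers, with projections -/

/-- Code of a finite sequence (tuple) of natural numbers; codes are nonzero. -/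
def tup (l : List ℕ) : ℕ := Encodable.encode l + 1

/-- The finite sequence coded by a natural number. -/
def untup (a : ℕ) : List ℕ := Denumerable.ofNat (List ℕ) (a - 1)

/-- The `i`-th projection `(a)_i`. -/
def proj (a i : ℕ) : ℕ := (untup a).getD i 0

/-- `a` codes a finite sequence (every nonzero number does, bijectively). -/
def InSeq (a : ℕ) : Prop := a ≠ 0

/-- The code of the empty sequence `⟨⟩` (the root). -/
def rootSeq : ℕ := tup []

/-- The code of `σ⌢i`. -/
def snoc (σ i : ℕ) : ℕ := tup (untup σ ++ [i])

/-! ### Names for the inference rules -/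

def axC : ℕ := 1
def andC : ℕ := 2
def orC : ℕ := 3
def omC : ℕ := 4
def exC : ℕ := 5
def cutC : ℕ := 6
def omrepC : ℕ := 7

/-- The end sequent of a (code of a) proof or proof node: `(a)_1` if the rule
`(a)_0` carries no main formula, and `(a)_1 ∪ {(a)_2}` otherwise. -/
def EndS (a : ℕ) : Finset Sentence :=
  if proj a 0 = cutC ∨ proj a 0 = axC ∨ proj a 0 = omrepC then decS (proj a 1)
  else decS (proj a 1) ∪ {decF (proj a 2)}

/-! ### Local codes of ω-proofs -/

/-- Local codes of `ω`-proofs, in Tait style.  The three `Bool` parameters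
respectively allow the cut rule, restrict the `ω`-rule to indices of primitive
recursive functions, and allow the vacuous `ω`-repetition rule. -/
inductive CGen (c p r : Bool) : ℕ → Prop
  | ax (Γ : Finset Sentence) (h : IsAxiom Γ) : CGen c p r (tup [axC, encS Γ])
  | and {a b : ℕ} (Γ : Finset Sentence) (A B : Sentence)
      (ha : CGen c p r a) (hb : CGen c p r b)
      (ea : EndS a = Γ ∪ {A}) (eb : EndS b = Γ ∪ {B}) :
      CGen c p r (tup [andC, encS Γ, encF (sAnd A B), a, b])
  | or {a : ℕ} (Γ : Finset Sentence) (A B : Sentence) (ha : CGen c p r a)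
      (ea : EndS a = Γ ∪ {A, B}) :
      CGen c p r (tup [orC, encS Γ, encF (sOr A B), a])
  | om {e : ℕ} (Γ : Finset Sentence) (A : Fml) (hA : A.cu 1 = true)
      (hp : p = true → PrimIndex e)
      (htot : ∀ n, (peval e n).Dom)
      (hmem : ∀ n, CGen c p r ((peval e n).get (htot n)))
      (hend : ∀ n, EndS ((peval e n).get (htot n)) = Γ ∪ {sInst A hA n}) :
      CGen c p r (tup [omC, encS Γ, encF (sAll A hA), e])
  | ex {a : ℕ} (Γ : Finset Sentence) (A : Fml) (hA : A.cu 1 = true) (n : ℕ)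
      (ha : CGen c p r a) (ea : EndS a = Γ ∪ {sInst A hA n}) :
      CGen c p r (tup [exC, encS Γ, encF (sEx A hA), a])
  | cut {a b : ℕ} (hc : c = true) (Γ : Finset Sentence) (C : Sentence)
      (ha : CGen c p r a) (hb : CGen c p r b)
      (ea : EndS a = Γ ∪ {C}) (eb : EndS b = Γ ∪ {sNeg C}) :
      CGen c p r (tup [cutC, encS Γ, encF C, a, b])
  | omrep {e : ℕ} (hr : r = true) (Γ : Finset Sentence) (hp : PrimIndex e)
      (htot : ∀ n, (peval e n).Dom)
      (hmem : ∀ n, CGen c p r ((peval e n).get (htot n)))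
      (hend : ∀ n, EndS ((peval e n).get (htot n)) = Γ) :
      CGen c p r (tup [omrepC, encS Γ, e])

/-- `C_rec`: recursive local codes of `ω`-proofs. -/
def Crec : ℕ → Prop := CGen true false false

/-- `C_rec^-`: the cut free fragment of `C_rec`. -/
def CrecM : ℕ → Prop := CGen false false false

/-- `C_prec`: primitive recursive local codes of `ω`-proofs. -/
def Cprec : ℕ → Prop := CGen true true false

/-- `C_prec^-`: the cut free fragment of `C_prec`. -/
def CprecM : ℕ → Prop := CGen false true false

/-- `C_prec^{ω-rep}`: `C_prec` with the vacuous `ω`-repetition rule. -/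
def CprecRep : ℕ → Prop := CGen true true true

/-! ### ω-proofs as well founded trees of sequents -/

/-- `σ` is a node of the tree `T_π = {σ ∈ Seq : π(σ) ∈ Seq}`. -/
def TreeOf (π : ℕ → ℕ) (σ : ℕ) : Prop := σ ≠ 0 ∧ π σ ≠ 0

/-- The tree `T_π` is well founded: it has no infinite branch. -/
def WFTree (π : ℕ → ℕ) : Prop :=
  ¬ ∃ f : ℕ → ℕ, ∀ n : ℕ, TreeOf π (tup ((List.range n).map f))

/-- The inference at an inner node of an `ω`-proof is a correct instance of one
of the rules of Tait-style `ω`-arithmetic. -/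
def CorrectInner (π : ℕ → ℕ) (σ : ℕ) : Prop :=
  (∃ (Γ : Finset Sentence) (A B : Sentence),
    π σ = tup [andC, encS Γ, encF (sAnd A B)] ∧
    TreeOf π (snoc σ 0) ∧ TreeOf π (snoc σ 1) ∧ ¬ TreeOf π (snoc σ 2) ∧
    EndS (π (snoc σ 0)) = Γ ∪ {A} ∧ EndS (π (snoc σ 1)) = Γ ∪ {B}) ∨
  (∃ (Γ : Finset Sentence) (A B : Sentence),
    π σ = tup [orC, encS Γ, encF (sOr A B)] ∧
    TreeOf π (snoc σ 0) ∧ ¬ TreeOf π (snoc σ 1) ∧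
    EndS (π (snoc σ 0)) = Γ ∪ {A, B}) ∨
  (∃ (Γ : Finset Sentence) (A : Fml) (hA : A.cu 1 = true),
    π σ = tup [omC, encS Γ, encF (sAll A hA)] ∧
    (∀ n : ℕ, TreeOf π (snoc σ n)) ∧
    (∀ n : ℕ, EndS (π (snoc σ n)) = Γ ∪ {sInst A hA n})) ∨
  (∃ (Γ : Finset Sentence) (A : Fml) (hA : A.cu 1 = true) (n : ℕ),
    π σ = tup [exC, encS Γ, encF (sEx A hA)] ∧
    TreeOf π (snoc σ 0) ∧ ¬ TreeOf π (snoc σ 1) ∧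
    EndS (π (snoc σ 0)) = Γ ∪ {sInst A hA n}) ∨
  (∃ (Γ : Finset Sentence) (C : Sentence),
    π σ = tup [cutC, encS Γ, encF C] ∧
    TreeOf π (snoc σ 0) ∧ TreeOf π (snoc σ 1) ∧ ¬ TreeOf π (snoc σ 2) ∧
    EndS (π (snoc σ 0)) = Γ ∪ {C} ∧ EndS (π (snoc σ 1)) = Γ ∪ {sNeg C})

/-- Local correctness of a function `π : ℕ → ℕ` viewed as a tree of sequents:
all conditions in the definition of `ω`-proof except well-foundedness. -/
structure LocallyCorrect (π : ℕ → ℕ) : Prop where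
  /-- values outside `Seq` are `0` -/
  nonseq : ∀ σ, ¬ InSeq (π σ) → π σ = 0
  /-- `T_π` is closed under initial segments -/
  downward : ∀ σ τ, TreeOf π σ → τ ≠ 0 → untup τ <+: untup σ → TreeOf π τ
  /-- children come first -/
  mono : ∀ σ i j, i < j → TreeOf π (snoc σ j) → TreeOf π (snoc σ i)
  /-- top nodes are axioms -/
  top : ∀ σ, TreeOf π σ → ¬ TreeOf π (snoc σ 0) →
    ∃ Γ : Finset Sentence, IsAxiom Γ ∧ π σ = tup [axC, encS Γ]
  /-- inner nodes are correct inferences -/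
  inner : ∀ σ, TreeOf π σ → TreeOf π (snoc σ 0) → CorrectInner π σ

/-- `π : ℕ → ℕ` is an `ω`-proof. -/
structure IsOmegaProof (π : ℕ → ℕ) extends LocallyCorrect π : Prop where
  /-- the tree `T_π` is well founded -/
  wf : WFTree π

/-- An `ω`-proof is cut free if no node is labelled `cut`. -/
def CutFree (π : ℕ → ℕ) : Prop := ∀ σ, TreeOf π σ → proj (π σ) 0 ≠ cutC

/-! ### The ω-proof `π(a)` coded by a local code `a` -/

open Classical in
/-- The code of the subproof at child `n` of the proof coded by `a`. -/
noncomputable def childCode (a n : ℕ) : ℕ :=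
  if proj a 0 = omC then
    (if h : (peval (proj a 3) n).Dom then (peval (proj a 3) n).get h else 0)
  else if proj a 0 = andC ∨ proj a 0 = orC ∨ proj a 0 = exC ∨ proj a 0 = cutC then
    proj a (n + 3)
  else 0

/-- Walk down a local code along a path. -/
noncomputable def walkCode (a : ℕ) : List ℕ → ℕ
  | [] => a
  | i :: l => walkCode (childCode a i) l

/-- The node label `⟨R,Γ,A⟩` (or `⟨Ax,Γ⟩`) determined by a local code. -/
def nodeVal (b : ℕ) : ℕ :=
  if proj b 0 = axC then tup [axC, proj b 1]
  else if proj b 0 = andC ∨ proj b 0 = orC ∨ proj b 0 = omC ∨ proj b 0 = exC ∨ proj b 0 = cutC then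
    tup [proj b 0, proj b 1, proj b 2]
  else 0

/-- The `ω`-proof `π(a)` determined by a local code `a` (with value `0` at all
other arguments). -/
noncomputable def piOf (a : ℕ) (σ : ℕ) : ℕ :=
  if σ = 0 then 0 else nodeVal (walkCode a (untup σ))

/-! ### Indices (global codes) of recursive and primitive recursive ω-proofs -/

/-- `I_rec`: `a` is an index of a recursive `ω`-proof. -/
def Irec (a : ℕ) : Prop :=
  ∃ h : ∀ n, (peval a n).Dom, IsOmegaProof (fun n => (peval a n).get (h n))

/-- `I_prec`: `a` is an index of a primitive recursive `ω`-proof. -/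
def Iprec (a : ℕ) : Prop :=
  ∃ f : ℕ → ℕ, Nat.Primrec f ∧ (∀ n, peval a n = Part.some (f n)) ∧ IsOmegaProof f

/-- `I_prec^-`: `a` is an index of a primitive recursive cut free `ω`-proof. -/
def IprecM (a : ℕ) : Prop :=
  ∃ f : ℕ → ℕ, Nat.Primrec f ∧ (∀ n, peval a n = Part.some (f n)) ∧
    IsOmegaProof f ∧ CutFree f

/-! ### Ordinal lengths -/

open Classical in
/-- `x + 1` if `P` holds, and `0` otherwise. -/
noncomputable def succIf (P : Prop) (x : Ordinal.{0}) : Ordinal.{0} :=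
  if P then x + 1 else 0

/-- The ordinal rank of a node of the tree `T_π`:
`rank σ = sup {rank (σ⌢i) + 1 : σ⌢i ∈ T_π}`. -/
inductive NodeRank (π : ℕ → ℕ) : ℕ → Ordinal.{0} → Prop
  | mk (σ : ℕ) (o : ℕ → Ordinal.{0})
      (h : ∀ i, TreeOf π (snoc σ i) → NodeRank π (snoc σ i) (o i)) :
      NodeRank π σ (⨆ i, succIf (TreeOf π (snoc σ i)) (o i))

/-- The ordinal length of a local code:  `|⟨Ax,Γ⟩| = 0`,
`|⟨R,Γ,A,a₁,…,a_k⟩| = sup{|a₁|,…,|a_k|} + 1`, and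
`|⟨ω,Γ,∀xA(x),e⟩| = sup{|⟨e⟩(n)| + 1 : n ∈ ℕ}`. -/
inductive CLen : ℕ → Ordinal.{0} → Prop
  | ax (g : ℕ) : CLen (tup [axC, g]) 0
  | one (R g x a : ℕ) (o : Ordinal.{0}) (hR : R = orC ∨ R = exC) (h : CLen a o) :
      CLen (tup [R, g, x, a]) (o + 1)
  | two (R g x a b : ℕ) (oa ob : Ordinal.{0}) (hR : R = andC ∨ R = cutC)
      (ha : CLen a oa) (hb : CLen b ob) :
      CLen (tup [R, g, x, a, b]) ((oa ⊔ ob) + 1)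
  | om (g x e : ℕ) (h : ∀ n, (peval e n).Dom) (o : ℕ → Ordinal.{0})
      (ho : ∀ n, CLen ((peval e n).get (h n)) (o n)) :
      CLen (tup [omC, g, x, e]) (⨆ n, o n + 1)

/-- The ordinal `|a|` of a notation `a ∈ O`:  `|1| = 0`, `|2^a| = |a| + 1`,
`|3·5^e| = sup{|⟨e⟩(n)| : n ∈ ℕ}`. -/
inductive KOrd : ℕ → Ordinal.{0} → Prop
  | one : KOrd 1 0
  | step {a : ℕ} {o : Ordinal.{0}} : KOrd a o → KOrd (2 ^ a) (o + 1)
  | lim {e : ℕ} (h : ∀ n, (peval e n).Dom) (o : ℕ → Ordinal.{0})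
      (ho : ∀ n, KOrd ((peval e n).get (h n)) (o n)) :
      KOrd (3 * 5 ^ e) (⨆ n, o n)


open Classical in
/-- One step of the sequence `a(f)` determined by a local code. -/
noncomputable def branchStep (b k : ℕ) : Option ℕ :=
  if (∃ (Γ : Finset Sentence) (A B : Sentence) (b₀ b₁ : ℕ),
        b = tup [andC, encS Γ, encF (sAnd A B), b₀, b₁]) ∨
     (∃ (Γ : Finset Sentence) (C : Sentence) (b₀ b₁ : ℕ),
        b = tup [cutC, encS Γ, encF C, b₀, b₁]) then
    some (proj b (3 + k % 2))
  else if ∃ (Γ : Finset Sentence) (A B : Sentence) (c : ℕ),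
      b = tup [orC, encS Γ, encF (sOr A B), c] then
    some (proj b 3)
  else if ∃ (Γ : Finset Sentence) (A : Fml) (hA : A.cu 1 = true) (e : ℕ),
      b = tup [omC, encS Γ, encF (sAll A hA), e] then
    (if h : (peval (proj b 3) k).Dom then some ((peval (proj b 3) k).get h) else none)
  else none

/-- The sequence `a(f) = ⟨a₀,a₁,…⟩`:  `chain a f i = some aᵢ` if the `i`-th
element of the sequence is defined, and `none` otherwise. -/
noncomputable def chain (a : ℕ) (f : ℕ → ℕ) : ℕ → Option ℕ
  | 0 => some a
  | i + 1 =>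
    match chain a f i with
    | none => none
    | some b => branchStep b (f i)

section Translation

open Encodable Denumerable
open Nat.Partrec (Code)

/-- Binary course-of-values recursion on `ℕ`, with a parameter `a` that is updated by `u`. -/
def treeRec {α σ : Type} (c₁ c₂ : ℕ → ℕ) (u : α → ℕ → α) (d : σ) (S : α → ℕ → σ → σ → σ)
    (a : α) (n : ℕ) : σ :=
  if _ : c₁ n < n ∧ c₂ n < n then
    S a n (treeRec c₁ c₂ u d S (u a n) (c₁ n)) (treeRec c₁ c₂ u d S (u a n) (c₂ n))
  else S a n d d
termination_by n

theorem treeRec_of_lt {α σ : Type} {c₁ c₂ : ℕ → ℕ} {u : α → ℕ → α} {d : σ}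
    {S : α → ℕ → σ → σ → σ} {a : α} {n : ℕ} (h₁ : c₁ n < n) (h₂ : c₂ n < n) :
    treeRec c₁ c₂ u d S a n =
      S a n (treeRec c₁ c₂ u d S (u a n) (c₁ n)) (treeRec c₁ c₂ u d S (u a n) (c₂ n)) := by
  rw [treeRec, dif_pos ⟨h₁, h₂⟩]

theorem exists_treeRec_eq {α σ : Type} (c₁ c₂ : ℕ → ℕ) (u : α → ℕ → α) (d : σ)
    (S : α → ℕ → σ → σ → σ) (a : α) (n : ℕ) : ∃ x y, treeRec c₁ c₂ u d S a n = S a n x y := by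
  rw [treeRec]
  split_ifs
  exacts [⟨_, _, rfl⟩, ⟨_, _, rfl⟩]

theorem primrec_treeRec {α σ : Type} [Primcodable α] [Primcodable σ]
    {c₁ c₂ : ℕ → ℕ} {u : α → ℕ → α} (d : σ) {S : α → ℕ → σ → σ → σ}
    (h₁ : Primrec c₁) (h₂ : Primrec c₂) (hu : Primrec₂ u)
    (hS : Primrec fun p : (α × ℕ) × (σ × σ) => S p.1.1 p.1.2 p.2.1 p.2.2) :
    Primrec₂ (treeRec c₁ c₂ u d S) := by
  have hu' : Primrec fun b : α × ℕ => u b.1 b.2 := hu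
  have hl : Primrec fun b : α × ℕ => if c₁ b.2 < b.2 ∧ c₂ b.2 < b.2 then
      [(u b.1 b.2, c₁ b.2), (u b.1 b.2, c₂ b.2)] else [] := by
    refine Primrec.ite ?_ ?_ (Primrec.const _)
    · exact (Primrec.nat_lt.comp (h₁.comp .snd) .snd).and
        (Primrec.nat_lt.comp (h₂.comp .snd) .snd)
    · exact Primrec.list_cons.comp (hu'.pair (h₁.comp .snd))
        (Primrec.list_cons.comp (hu'.pair (h₂.comp .snd)) (.const []))
  refine Primrec.nat_omega_rec' (fun b : α × ℕ => treeRec c₁ c₂ u d S b.1 b.2)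
    (m := Prod.snd) (g := fun b l => some (S b.1 b.2 (l.getD 0 d) (l.getD 1 d)))
    .snd hl ?_ ?_ ?_
  · exact Primrec.option_some.comp (hS.comp (Primrec.fst.pair
      (((Primrec.list_getD d).comp .snd (.const 0)).pair
        ((Primrec.list_getD d).comp .snd (.const 1)))))
  · rintro ⟨a, n⟩ ⟨a', n'⟩ h
    dsimp only at h ⊢
    split_ifs at h with hn
    · simp only [List.mem_cons, Prod.mk.injEq, List.not_mem_nil, or_false] at h
      rcases h with ⟨-, rfl⟩ | ⟨-, rfl⟩
      exacts [hn.1, hn.2]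
    · simp at h
  · rintro ⟨a, n⟩
    dsimp only
    rw [treeRec]
    split_ifs with hn <;> simp

/-- Gödel number of the numeral `n̄`. -/
def numeralN (n : ℕ) : ℕ := (numeral n).enc

theorem primrec_numeralN : Primrec numeralN := by
  refine (Primrec.nat_rec₁ 1 (f := fun _ t => 5 * Nat.pair t 2 + 3) ?_).of_eq fun n => ?_
  · exact Primrec.nat_add.comp (Primrec.nat_mul.comp (.const 5)
      (Primrec₂.natPair.comp .snd (.const 2))) (.const 3)
  · induction n with
    | zero => rfl
    | succ n ih => simp only [ih]; rfl

theorem le_numeralN (n : ℕ) : n ≤ numeralN n := by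
  induction n with
  | zero => exact Nat.zero_le _
  | succ n ih =>
    have := Nat.left_le_pair (numeral n).enc 2
    simp only [numeralN, numeral, Trm.enc] at *
    omega

/-- First immediate subterm of a term, on Gödel numbers. -/
def trmLeft (n : ℕ) : ℕ := (n / 5).unpair.1

/-- Second immediate subterm of a term, on Gödel numbers. -/
def trmRight (n : ℕ) : ℕ := (n / 5).unpair.2

theorem primrec_trmLeft : Primrec trmLeft :=
  Primrec.fst.comp (Primrec.unpair.comp (Primrec.nat_div.comp .id (.const 5)))

theorem primrec_trmRight : Primrec trmRight :=
  Primrec.snd.comp (Primrec.unpair.comp (Primrec.nat_div.comp .id (.const 5)))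

theorem trmLeft_lt {n : ℕ} (h : 0 < n) : trmLeft n < n :=
  (Nat.unpair_left_le _).trans_lt (Nat.div_lt_self h (by norm_num))

theorem trmRight_lt {n : ℕ} (h : 0 < n) : trmRight n < n :=
  (Nat.unpair_right_le _).trans_lt (Nat.div_lt_self h (by norm_num))

/-- Recursion step of `valN`. -/
def valStep (_ : Unit) (n x y : ℕ) : ℕ :=
  if n % 5 = 2 then 1 else if n % 5 = 3 then x + y else if n % 5 = 4 then x * y else 0

/-- Value of a term under the zero environment, on Gödel numbers. -/
def valN : ℕ → ℕ := treeRec trmLeft trmRight (fun (_ : Unit) _ => ()) 0 valStep ()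

theorem primrec_mod_eq (k r : ℕ) : PrimrecPred fun n : ℕ => n % k = r :=
  Primrec.eq.comp (Primrec.nat_mod.comp .id (.const k)) (.const r)

theorem primrec_valN : Primrec valN := by
  refine (primrec_treeRec 0 primrec_trmLeft primrec_trmRight (Primrec.const ()).to₂ ?_).comp
    (.const ()) .id
  have hn : Primrec fun p : (Unit × ℕ) × (ℕ × ℕ) => p.1.2 := Primrec.snd.comp .fst
  have hx : Primrec fun p : (Unit × ℕ) × (ℕ × ℕ) => p.2.1 := Primrec.fst.comp .snd
  have hy : Primrec fun p : (Unit × ℕ) × (ℕ × ℕ) => p.2.2 := Primrec.snd.comp .snd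
  exact Primrec.ite ((primrec_mod_eq 5 2).comp hn) (.const 1) <|
    Primrec.ite ((primrec_mod_eq 5 3).comp hn) (Primrec.nat_add.comp hx hy) <|
    Primrec.ite ((primrec_mod_eq 5 4).comp hn) (Primrec.nat_mul.comp hx hy) (.const 0)

theorem trmLeft_pair (a b : ℕ) {r : ℕ} (hr : r < 5) : trmLeft (5 * Nat.pair a b + r) = a := by
  have : (5 * Nat.pair a b + r) / 5 = Nat.pair a b := by omega
  rw [trmLeft, this, Nat.unpair_pair]

theorem trmRight_pair (a b : ℕ) {r : ℕ} (hr : r < 5) : trmRight (5 * Nat.pair a b + r) = b := by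
  have : (5 * Nat.pair a b + r) / 5 = Nat.pair a b := by omega
  rw [trmRight, this, Nat.unpair_pair]

theorem valN_enc (t : Trm) : valN t.enc = t.val fun _ => 0 := by
  induction t with
  | var i =>
    obtain ⟨x, y, h⟩ := exists_treeRec_eq trmLeft trmRight (fun (_ : Unit) _ => ()) 0 valStep ()
      (Trm.var i).enc
    rw [valN, h]
    simp [valStep, Trm.enc, Trm.val]
  | zero =>
    obtain ⟨x, y, h⟩ := exists_treeRec_eq trmLeft trmRight (fun (_ : Unit) _ => ()) 0 valStep ()
      Trm.zero.enc
    rw [valN, h]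
    simp [valStep, Trm.enc, Trm.val]
  | one =>
    obtain ⟨x, y, h⟩ := exists_treeRec_eq trmLeft trmRight (fun (_ : Unit) _ => ()) 0 valStep ()
      Trm.one.enc
    rw [valN, h]
    simp [valStep, Trm.enc, Trm.val]
  | add s t hs ht =>
    simp only [valN, Trm.enc, Trm.val] at *
    rw [treeRec_of_lt (trmLeft_lt (by omega)) (trmRight_lt (by omega)),
      trmLeft_pair _ _ (by omega), trmRight_pair _ _ (by omega), hs, ht]
    simp [valStep]
  | mul s t hs ht =>
    simp only [valN, Trm.enc, Trm.val] at *
    rw [treeRec_of_lt (trmLeft_lt (by omega)) (trmRight_lt (by omega)),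
      trmLeft_pair _ _ (by omega), trmRight_pair _ _ (by omega), hs, ht]
    simp [valStep]

/-- Recursion step of `subTrmN`. -/
def subTrmStep (p : ℕ × ℕ) (n x y : ℕ) : ℕ :=
  if n % 5 = 0 then
    if n / 5 = p.2 then p.1 else if p.2 < n / 5 then 5 * (n / 5 - 1) else n
  else if n % 5 = 3 then 5 * Nat.pair x y + 3
  else if n % 5 = 4 then 5 * Nat.pair x y + 4 else n

/-- Substitution of the term `p.1` for the variable `p.2` in a term, on Gödel numbers. -/
def subTrmN (p : ℕ × ℕ) : ℕ → ℕ := treeRec trmLeft trmRight (fun p _ => p) 0 subTrmStep p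

theorem primrec_tagged {α : Type} [Primcodable α] {f : α → ℕ} (hf : Primrec f) (k r : ℕ) :
    Primrec fun a => k * f a + r :=
  Primrec.nat_add.comp (Primrec.nat_mul.comp (.const k) hf) (.const r)

theorem primrec_subTrmN : Primrec₂ subTrmN := by
  refine primrec_treeRec 0 primrec_trmLeft primrec_trmRight Primrec.fst.to₂ ?_
  have ht : Primrec fun p : ((ℕ × ℕ) × ℕ) × (ℕ × ℕ) => p.1.1.1 :=
    Primrec.fst.comp (Primrec.fst.comp .fst)
  have hk : Primrec fun p : ((ℕ × ℕ) × ℕ) × (ℕ × ℕ) => p.1.1.2 :=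
    Primrec.snd.comp (Primrec.fst.comp .fst)
  have hn : Primrec fun p : ((ℕ × ℕ) × ℕ) × (ℕ × ℕ) => p.1.2 := Primrec.snd.comp .fst
  have hd : Primrec fun p : ((ℕ × ℕ) × ℕ) × (ℕ × ℕ) => p.1.2 / 5 :=
    Primrec.nat_div.comp hn (.const 5)
  have hxy : Primrec fun p : ((ℕ × ℕ) × ℕ) × (ℕ × ℕ) => Nat.pair p.2.1 p.2.2 :=
    Primrec₂.natPair.comp (Primrec.fst.comp .snd) (Primrec.snd.comp .snd)
  exact Primrec.ite ((primrec_mod_eq 5 0).comp hn)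
    (Primrec.ite (Primrec.eq.comp hd hk) ht <| Primrec.ite (Primrec.nat_lt.comp hk hd)
      (primrec_tagged (Primrec.nat_sub.comp hd (.const 1)) 5 0) hn) <|
    Primrec.ite ((primrec_mod_eq 5 3).comp hn) (primrec_tagged hxy 5 3) <|
    Primrec.ite ((primrec_mod_eq 5 4).comp hn) (primrec_tagged hxy 5 4) hn

theorem subTrmN_enc (t : Trm) (k : ℕ) (s : Trm) :
    subTrmN (t.enc, k) s.enc = (Trm.sub t k s).enc := by
  induction s with
  | var i =>
    obtain ⟨x, y, h⟩ := exists_treeRec_eq trmLeft trmRight (fun p _ => p) 0 subTrmStep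
      (t.enc, k) (Trm.var i).enc
    have hi : 5 * i / 5 = i := by omega
    rw [subTrmN, h]
    simp only [subTrmStep, Trm.enc, Trm.sub, Nat.mul_mod_right, if_true, hi]
    split_ifs <;> rfl
  | zero =>
    obtain ⟨x, y, h⟩ := exists_treeRec_eq trmLeft trmRight (fun p _ => p) 0 subTrmStep
      (t.enc, k) Trm.zero.enc
    rw [subTrmN, h]
    simp [subTrmStep, Trm.enc, Trm.sub]
  | one =>
    obtain ⟨x, y, h⟩ := exists_treeRec_eq trmLeft trmRight (fun p _ => p) 0 subTrmStep
      (t.enc, k) Trm.one.enc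
    rw [subTrmN, h]
    simp [subTrmStep, Trm.enc, Trm.sub]
  | add s t hs ht =>
    simp only [subTrmN, Trm.enc, Trm.sub] at *
    rw [treeRec_of_lt (trmLeft_lt (by omega)) (trmRight_lt (by omega)),
      trmLeft_pair _ _ (by omega), trmRight_pair _ _ (by omega), hs, ht]
    simp [subTrmStep]
  | mul s t hs ht =>
    simp only [subTrmN, Trm.enc, Trm.sub] at *
    rw [treeRec_of_lt (trmLeft_lt (by omega)) (trmRight_lt (by omega)),
      trmLeft_pair _ _ (by omega), trmRight_pair _ _ (by omega), hs, ht]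
    simp [subTrmStep]

/-- First immediate subformula (or subterm) of a formula, on Gödel numbers. -/
def fmlLeft (n : ℕ) : ℕ := if 4 ≤ n % 6 then n / 6 else (n / 6).unpair.1

/-- Second immediate subformula (or subterm) of a formula, on Gödel numbers. -/
def fmlRight (n : ℕ) : ℕ := (n / 6).unpair.2

theorem primrec_fmlLeft : Primrec fmlLeft := by
  have h : Primrec fun n : ℕ => n / 6 := Primrec.nat_div.comp .id (.const 6)
  exact Primrec.ite (Primrec.nat_le.comp (.const 4) (Primrec.nat_mod.comp .id (.const 6))) h
    (Primrec.fst.comp (Primrec.unpair.comp h))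

theorem primrec_fmlRight : Primrec fmlRight :=
  Primrec.snd.comp (Primrec.unpair.comp (Primrec.nat_div.comp .id (.const 6)))

theorem fmlLeft_lt {n : ℕ} (h : 0 < n) : fmlLeft n < n := by
  have := Nat.div_lt_self h (show 1 < 6 by norm_num)
  rw [fmlLeft]
  split_ifs
  · exact this
  · exact (Nat.unpair_left_le _).trans_lt this

theorem fmlRight_lt {n : ℕ} (h : 0 < n) : fmlRight n < n :=
  (Nat.unpair_right_le _).trans_lt (Nat.div_lt_self h (by norm_num))

theorem fmlLeft_pair (a b : ℕ) {r : ℕ} (hr : r < 4) : fmlLeft (6 * Nat.pair a b + r) = a := by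
  have h : (6 * Nat.pair a b + r) / 6 = Nat.pair a b := by omega
  have h' : ¬ 4 ≤ (6 * Nat.pair a b + r) % 6 := by omega
  rw [fmlLeft, if_neg h', h, Nat.unpair_pair]

theorem fmlRight_pair (a b : ℕ) {r : ℕ} (hr : r < 4) : fmlRight (6 * Nat.pair a b + r) = b := by
  have : (6 * Nat.pair a b + r) / 6 = Nat.pair a b := by omega
  rw [fmlRight, this, Nat.unpair_pair]

theorem fmlLeft_quant (a : ℕ) {r : ℕ} (hr : 4 ≤ r) (hr' : r < 6) : fmlLeft (6 * a + r) = a := by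
  have h' : 4 ≤ (6 * a + r) % 6 := by omega
  rw [fmlLeft, if_pos h']
  omega

/-- Recursion step of `negN`. -/
def negStep (_ : Unit) (n x y : ℕ) : ℕ :=
  if n % 6 = 0 then n + 1
  else if n % 6 = 1 then n - 1
  else if n % 6 = 2 then 6 * Nat.pair x y + 3
  else if n % 6 = 3 then 6 * Nat.pair x y + 2
  else if n % 6 = 4 then 6 * x + 5
  else 6 * x + 4

/-- De Morgan dual of a formula, on Gödel numbers. -/
def negN : ℕ → ℕ := treeRec fmlLeft fmlRight (fun (_ : Unit) _ => ()) 0 negStep ()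

theorem primrec_negN : Primrec negN := by
  refine (primrec_treeRec 0 primrec_fmlLeft primrec_fmlRight (Primrec.const ()).to₂ ?_).comp
    (.const ()) .id
  have hn : Primrec fun p : (Unit × ℕ) × (ℕ × ℕ) => p.1.2 := Primrec.snd.comp .fst
  have hx : Primrec fun p : (Unit × ℕ) × (ℕ × ℕ) => p.2.1 := Primrec.fst.comp .snd
  have hxy : Primrec fun p : (Unit × ℕ) × (ℕ × ℕ) => Nat.pair p.2.1 p.2.2 :=
    Primrec₂.natPair.comp hx (Primrec.snd.comp .snd)
  exact Primrec.ite ((primrec_mod_eq 6 0).comp hn) (Primrec.succ.comp hn) <|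
    Primrec.ite ((primrec_mod_eq 6 1).comp hn) (Primrec.nat_sub.comp hn (.const 1)) <|
    Primrec.ite ((primrec_mod_eq 6 2).comp hn) (primrec_tagged hxy 6 3) <|
    Primrec.ite ((primrec_mod_eq 6 3).comp hn) (primrec_tagged hxy 6 2) <|
    Primrec.ite ((primrec_mod_eq 6 4).comp hn) (primrec_tagged hx 6 5) (primrec_tagged hx 6 4)

theorem negN_enc (A : Fml) : negN A.enc = A.neg.enc := by
  induction A with
  | eq s t =>
    obtain ⟨x, y, h⟩ := exists_treeRec_eq fmlLeft fmlRight (fun (_ : Unit) _ => ()) 0 negStep ()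
      (Fml.eq s t).enc
    rw [negN, h]
    simp [negStep, Fml.enc, Fml.neg]
  | ne s t =>
    obtain ⟨x, y, h⟩ := exists_treeRec_eq fmlLeft fmlRight (fun (_ : Unit) _ => ()) 0 negStep ()
      (Fml.ne s t).enc
    rw [negN, h]
    simp [negStep, Fml.enc, Fml.neg]
  | and A B hA hB =>
    simp only [negN, Fml.enc, Fml.neg] at *
    rw [treeRec_of_lt (fmlLeft_lt (by omega)) (fmlRight_lt (by omega)),
      fmlLeft_pair _ _ (by omega), fmlRight_pair _ _ (by omega), hA, hB]
    simp [negStep]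
  | or A B hA hB =>
    simp only [negN, Fml.enc, Fml.neg] at *
    rw [treeRec_of_lt (fmlLeft_lt (by omega)) (fmlRight_lt (by omega)),
      fmlLeft_pair _ _ (by omega), fmlRight_pair _ _ (by omega), hA, hB]
    simp [negStep]
  | all A hA =>
    simp only [negN, Fml.enc, Fml.neg] at *
    rw [treeRec_of_lt (fmlLeft_lt (by omega)) (fmlRight_lt (by omega)),
      fmlLeft_quant _ (by omega) (by omega), hA]
    simp [negStep]
  | ex A hA =>
    simp only [negN, Fml.enc, Fml.neg] at *
    rw [treeRec_of_lt (fmlLeft_lt (by omega)) (fmlRight_lt (by omega)),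
      fmlLeft_quant _ (by omega) (by omega), hA]
    simp [negStep]

/-- Parameter update of `subFmlN`: the variable index is shifted below a quantifier. -/
def subFmlParam (p : ℕ × ℕ) (n : ℕ) : ℕ × ℕ := if 4 ≤ n % 6 then (p.1, p.2 + 1) else p

/-- Recursion step of `subFmlN`. -/
def subFmlStep (p : ℕ × ℕ) (n x y : ℕ) : ℕ :=
  if n % 6 < 2 then
    6 * Nat.pair (subTrmN p (fmlLeft n)) (subTrmN p (fmlRight n)) + n % 6
  else if n % 6 < 4 then 6 * Nat.pair x y + n % 6
  else 6 * x + n % 6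

/-- Substitution of the term `p.1` for the variable `p.2` in a formula, on Gödel numbers. -/
def subFmlN (p : ℕ × ℕ) : ℕ → ℕ := treeRec fmlLeft fmlRight subFmlParam 0 subFmlStep p

theorem primrec_subFmlN : Primrec₂ subFmlN := by
  have hmod : Primrec fun n : ℕ => n % 6 := Primrec.nat_mod.comp .id (.const 6)
  refine primrec_treeRec 0 primrec_fmlLeft primrec_fmlRight ?_ ?_
  · exact Primrec.ite (Primrec.nat_le.comp (.const 4) (hmod.comp .snd))
      ((Primrec.fst.comp .fst).pair (Primrec.succ.comp (Primrec.snd.comp .fst))) .fst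
  have hp : Primrec fun p : ((ℕ × ℕ) × ℕ) × (ℕ × ℕ) => p.1.1 := Primrec.fst.comp .fst
  have hn : Primrec fun p : ((ℕ × ℕ) × ℕ) × (ℕ × ℕ) => p.1.2 := Primrec.snd.comp .fst
  have hx : Primrec fun p : ((ℕ × ℕ) × ℕ) × (ℕ × ℕ) => p.2.1 := Primrec.fst.comp .snd
  have hy : Primrec fun p : ((ℕ × ℕ) × ℕ) × (ℕ × ℕ) => p.2.2 := Primrec.snd.comp .snd
  have htag {f : ((ℕ × ℕ) × ℕ) × (ℕ × ℕ) → ℕ} (hf : Primrec f) :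
      Primrec fun p : ((ℕ × ℕ) × ℕ) × (ℕ × ℕ) => 6 * f p + p.1.2 % 6 :=
    Primrec.nat_add.comp (Primrec.nat_mul.comp (.const 6) hf) (hmod.comp hn)
  exact Primrec.ite (Primrec.nat_lt.comp (hmod.comp hn) (.const 2))
    (htag (Primrec₂.natPair.comp (primrec_subTrmN.comp hp (primrec_fmlLeft.comp hn))
      (primrec_subTrmN.comp hp (primrec_fmlRight.comp hn)))) <|
    Primrec.ite (Primrec.nat_lt.comp (hmod.comp hn) (.const 4))
      (htag (Primrec₂.natPair.comp hx hy)) (htag hx)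

theorem subFmlN_enc (t : Trm) (A : Fml) :
    ∀ k, subFmlN (t.enc, k) A.enc = (A.sub t k).enc := by
  induction A with
  | eq s u =>
    intro k
    have h₁ := fmlLeft_pair s.enc u.enc (r := 0) (by omega)
    have h₂ := fmlRight_pair s.enc u.enc (r := 0) (by omega)
    rw [add_zero] at h₁ h₂
    obtain ⟨x, y, h⟩ := exists_treeRec_eq fmlLeft fmlRight subFmlParam 0 subFmlStep (t.enc, k)
      (Fml.eq s u).enc
    rw [subFmlN, h]
    simp [subFmlStep, Fml.enc, Fml.sub, h₁, h₂, subTrmN_enc]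
  | ne s u =>
    intro k
    have h₁ := fmlLeft_pair s.enc u.enc (r := 1) (by omega)
    have h₂ := fmlRight_pair s.enc u.enc (r := 1) (by omega)
    obtain ⟨x, y, h⟩ := exists_treeRec_eq fmlLeft fmlRight subFmlParam 0 subFmlStep (t.enc, k)
      (Fml.ne s u).enc
    rw [subFmlN, h]
    simp [subFmlStep, Fml.enc, Fml.sub, h₁, h₂, subTrmN_enc]
  | and A B hA hB =>
    intro k
    simp only [subFmlN, Fml.enc, Fml.sub] at *
    have hu : subFmlParam (t.enc, k) (6 * Nat.pair A.enc B.enc + 2) = (t.enc, k) :=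
      if_neg (by omega)
    rw [treeRec_of_lt (fmlLeft_lt (by omega)) (fmlRight_lt (by omega)),
      fmlLeft_pair _ _ (by omega), fmlRight_pair _ _ (by omega), hu, hA, hB]
    simp [subFmlStep]
  | or A B hA hB =>
    intro k
    simp only [subFmlN, Fml.enc, Fml.sub] at *
    have hu : subFmlParam (t.enc, k) (6 * Nat.pair A.enc B.enc + 3) = (t.enc, k) :=
      if_neg (by omega)
    rw [treeRec_of_lt (fmlLeft_lt (by omega)) (fmlRight_lt (by omega)),
      fmlLeft_pair _ _ (by omega), fmlRight_pair _ _ (by omega), hu, hA, hB]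
    simp [subFmlStep]
  | all A hA =>
    intro k
    simp only [subFmlN, Fml.enc, Fml.sub] at *
    have hu : subFmlParam (t.enc, k) (6 * A.enc + 4) = (t.enc, k + 1) := if_pos (by omega)
    rw [treeRec_of_lt (fmlLeft_lt (by omega)) (fmlRight_lt (by omega)),
      fmlLeft_quant _ (by omega) (by omega), hu, hA]
    simp [subFmlStep]
  | ex A hA =>
    intro k
    simp only [subFmlN, Fml.enc, Fml.sub] at *
    have hu : subFmlParam (t.enc, k) (6 * A.enc + 5) = (t.enc, k + 1) := if_pos (by omega)
    rw [treeRec_of_lt (fmlLeft_lt (by omega)) (fmlRight_lt (by omega)),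
      fmlLeft_quant _ (by omega) (by omega), hu, hA]
    simp [subFmlStep]

theorem Trm.enc_le_enc_sub_or (k : ℕ) (s : Trm) :
    (∀ t, t.enc ≤ (Trm.sub t k s).enc) ∨ ∀ t t', Trm.sub t k s = Trm.sub t' k s := by
  induction s with
  | var i =>
    by_cases h : i = k
    · exact .inl fun t => by simp [Trm.sub, h]
    · exact .inr fun t t' => by simp [Trm.sub, h]
  | zero => exact .inr fun _ _ => rfl
  | one => exact .inr fun _ _ => rfl
  | add s u hs hu =>
    have hl := fun t => Nat.left_le_pair (Trm.sub t k s).enc (Trm.sub t k u).enc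
    have hr := fun t => Nat.right_le_pair (Trm.sub t k s).enc (Trm.sub t k u).enc
    simp only [Trm.sub, Trm.enc, Trm.add.injEq]
    grind
  | mul s u hs hu =>
    have hl := fun t => Nat.left_le_pair (Trm.sub t k s).enc (Trm.sub t k u).enc
    have hr := fun t => Nat.right_le_pair (Trm.sub t k s).enc (Trm.sub t k u).enc
    simp only [Trm.sub, Trm.enc, Trm.mul.injEq]
    grind

theorem Fml.enc_le_enc_sub_or (A : Fml) :
    ∀ k, (∀ t, t.enc ≤ (A.sub t k).enc) ∨ ∀ t t', A.sub t k = A.sub t' k := by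
  induction A with
  | eq s u =>
    intro k
    have hs := Trm.enc_le_enc_sub_or k s
    have hu := Trm.enc_le_enc_sub_or k u
    have hl := fun t => Nat.left_le_pair (Trm.sub t k s).enc (Trm.sub t k u).enc
    have hr := fun t => Nat.right_le_pair (Trm.sub t k s).enc (Trm.sub t k u).enc
    simp only [Fml.sub, Fml.enc, Fml.eq.injEq]
    grind
  | ne s u =>
    intro k
    have hs := Trm.enc_le_enc_sub_or k s
    have hu := Trm.enc_le_enc_sub_or k u
    have hl := fun t => Nat.left_le_pair (Trm.sub t k s).enc (Trm.sub t k u).enc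
    have hr := fun t => Nat.right_le_pair (Trm.sub t k s).enc (Trm.sub t k u).enc
    simp only [Fml.sub, Fml.enc, Fml.ne.injEq]
    grind
  | and A B hA hB =>
    intro k
    have hA := hA k
    have hB := hB k
    have hl := fun t => Nat.left_le_pair (A.sub t k).enc (B.sub t k).enc
    have hr := fun t => Nat.right_le_pair (A.sub t k).enc (B.sub t k).enc
    simp only [Fml.sub, Fml.enc, Fml.and.injEq]
    grind
  | or A B hA hB =>
    intro k
    have hA := hA k
    have hB := hB k
    have hl := fun t => Nat.left_le_pair (A.sub t k).enc (B.sub t k).enc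
    have hr := fun t => Nat.right_le_pair (A.sub t k).enc (B.sub t k).enc
    simp only [Fml.sub, Fml.enc, Fml.or.injEq]
    grind
  | all A hA =>
    intro k
    have hA := hA (k + 1)
    simp only [Fml.sub, Fml.enc, Fml.all.injEq]
    grind
  | ex A hA =>
    intro k
    have hA := hA (k + 1)
    simp only [Fml.sub, Fml.enc, Fml.ex.injEq]
    grind

theorem lt_encode_of_mem {x : ℕ} {l : List ℕ} (h : x ∈ l) : x < encode l := by
  induction l with
  | nil => simp at h
  | cons y l ih =>
    rw [encode_list_cons, encode_nat, Nat.lt_succ_iff]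
    rcases List.mem_cons.1 h with rfl | h
    · exact Nat.left_le_pair _ _
    · exact (ih h).le.trans (Nat.right_le_pair _ _)

/-- The increasing list of the elements of `l`. -/
def canon (l : List ℕ) : List ℕ := (List.range (encode l)).filter (· ∈ l)

theorem primrecRel_mem : PrimrecRel fun (x : ℕ) (l : List ℕ) => x ∈ l :=
  (((Primrec.eq (α := ℕ)).exists_mem_list).comp₂ Primrec₂.right Primrec₂.left).of_eq
    fun x l => by simp

theorem primrec_canon : Primrec canon :=
  primrecRel_mem.listFilter.comp (Primrec.list_range.comp Primrec.encode) .id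

theorem mem_canon {x : ℕ} {l : List ℕ} : x ∈ canon l ↔ x ∈ l := by
  simpa [canon] using fun h => lt_encode_of_mem h

theorem sortedLT_canon (l : List ℕ) : (canon l).SortedLT :=
  (List.pairwise_lt_range.filter _).sortedLT

theorem canon_eq_self {l : List ℕ} (h : l.SortedLT) : canon l = l :=
  (sortedLT_canon l).eq_of_mem_iff h fun _ => mem_canon

theorem encF_injective : Function.Injective encF := encode_injective

theorem encF_eq (A : Sentence) : encF A = A.1.enc := Subtype.encode_eq A

/-- The increasing list of the Gödel numbers of the members of a sequent. -/
def codes (Γ : Finset Sentence) : List ℕ := ofNat (List ℕ) (encS Γ)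

theorem encode_codes (Γ : Finset Sentence) : encode (codes Γ) = encS Γ := encode_ofNat _

theorem encode_map_encode {α : Type*} [Encodable α] (l : List α) :
    encode (l.map encode) = encode l := by
  induction l with
  | nil => rfl
  | cons a l ih => simp [ih]

theorem exists_sorted_codes_eq (Γ : Finset Sentence) :
    ∃ l : List Sentence, l.Pairwise (encode · ≤ encode ·) ∧ (l : Multiset Sentence) = Γ.val ∧
      codes Γ = l.map encF := by
  have : IsLinearOrder Sentence (encode ⁻¹'o (· ≤ ·)) :=
    (RelEmbedding.preimage ⟨encode, encode_injective⟩ (· ≤ ·)).isLinearOrder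
  have hs := Multiset.pairwise_sort Γ.val (encode ⁻¹'o (· ≤ ·))
  refine ⟨Γ.val.sort (encode ⁻¹'o (· ≤ ·)), hs, Multiset.sort_eq .., ?_⟩
  rw [← encode_inj, encode_codes]
  exact (encode_map_encode (Γ.val.sort (encode ⁻¹'o (· ≤ ·)))).symm

theorem sortedLT_codes (Γ : Finset Sentence) : (codes Γ).SortedLT := by
  obtain ⟨l, hs, hl, h⟩ := exists_sorted_codes_eq Γ
  have hn : l.Nodup := Multiset.coe_nodup.1 (hl ▸ Γ.nodup)
  rw [h]
  refine (List.pairwise_map.2 ?_).sortedLT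
  exact (hs.and hn).imp fun h => lt_of_le_of_ne h.1 (encF_injective.ne h.2)

theorem mem_codes {Γ : Finset Sentence} {x : ℕ} : x ∈ codes Γ ↔ ∃ A ∈ Γ, encF A = x := by
  obtain ⟨l, -, hl, h⟩ := exists_sorted_codes_eq Γ
  rw [h]
  simp [← Finset.mem_val, ← hl]

theorem eq_codes {l : List ℕ} {Γ : Finset Sentence} (hl : l.SortedLT)
    (h : ∀ x, x ∈ l ↔ ∃ A ∈ Γ, encF A = x) : l = codes Γ :=
  hl.eq_of_mem_iff (sortedLT_codes Γ) fun x => (h x).trans mem_codes.symm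

theorem exists_eq_codes {l : List ℕ} (hl : l.SortedLT) (h : ∀ x ∈ l, ∃ A, encF A = x) :
    ∃ Γ, l = codes Γ := by
  refine ⟨l.toFinset.preimage encF encF_injective.injOn, eq_codes hl fun x => ⟨fun hx => ?_, ?_⟩⟩
  · obtain ⟨A, rfl⟩ := h x hx
    exact ⟨A, by simpa using hx, rfl⟩
  · rintro ⟨A, hA, rfl⟩
    simpa using hA

theorem canon_codes_append (Γ Δ : Finset Sentence) :
    canon (codes Γ ++ codes Δ) = codes (Γ ∪ Δ) :=
  eq_codes (sortedLT_canon _) fun x => by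
    simp only [mem_canon, List.mem_append, mem_codes, Finset.mem_union]
    grind

theorem canon_encF_cons (A : Sentence) (Γ : Finset Sentence) :
    canon (encF A :: codes Γ) = codes (Γ ∪ {A}) :=
  eq_codes (sortedLT_canon _) fun x => by
    simp only [mem_canon, List.mem_cons, mem_codes, Finset.mem_union, Finset.mem_singleton]
    grind

theorem canon_encF_cons_cons (A B : Sentence) (Γ : Finset Sentence) :
    canon (encF A :: encF B :: codes Γ) = codes (Γ ∪ {A, B}) :=
  eq_codes (sortedLT_canon _) fun x => by
    simp only [mem_canon, List.mem_cons, mem_codes, Finset.mem_union, Finset.mem_singleton,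
      Finset.mem_insert]
    grind

theorem canon_encF_cons_append (A : Sentence) (Γ Δ : Finset Sentence) :
    canon (encF A :: (codes Γ ++ codes Δ)) = codes (Γ ∪ Δ ∪ {A}) :=
  eq_codes (sortedLT_canon _) fun x => by
    simp only [mem_canon, List.mem_append, List.mem_cons, mem_codes, Finset.mem_union,
      Finset.mem_singleton]
    grind

theorem decS_encS (Γ : Finset Sentence) : decS (encS Γ) = Γ := by
  simp [decS, encS]

theorem decF_encF (A : Sentence) : decF (encF A) = A := by
  simp [decF, encF]

theorem untup_tup (l : List ℕ) : untup (tup l) = l := by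
  simp [untup, tup]

theorem tup_injective : Function.Injective tup := fun l l' h => by
  rw [← untup_tup l, h, untup_tup]

theorem tup_ne_zero (l : List ℕ) : tup l ≠ 0 := Nat.succ_ne_zero _

theorem proj_tup (l : List ℕ) (i : ℕ) : proj (tup l) i = l.getD i 0 := by
  rw [proj, untup_tup]

theorem proj_lt {a : ℕ} (h : 0 < a) (i : ℕ) : proj a i < a := by
  rw [proj]
  by_cases hi : i < (untup a).length
  · rw [List.getD_eq_getElem _ _ hi]
    refine (lt_encode_of_mem (List.getElem_mem hi)).trans ?_
    rw [untup, encode_ofNat]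
    omega
  · rwa [List.getD_eq_default _ _ (not_lt.1 hi)]

theorem primrec_proj : Primrec₂ proj :=
  (Primrec.list_getD 0).comp ((Primrec.ofNat (List ℕ)).comp (Primrec.nat_sub.comp .fst (.const 1)))
    .snd

theorem primrec_tup : Primrec tup := Primrec.succ.comp Primrec.encode

/-- The end sequent of a local code, on Gödel numbers. -/
def endN (a : ℕ) : ℕ :=
  if proj a 0 = cutC ∨ proj a 0 = axC ∨ proj a 0 = omrepC then proj a 1
  else encode (canon (proj a 2 :: ofNat (List ℕ) (proj a 1)))

theorem primrec_endN : Primrec endN := by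
  have h (i : ℕ) : Primrec fun a => proj a i := primrec_proj.comp .id (.const i)
  have he (r : ℕ) : PrimrecPred fun a => proj a 0 = r := Primrec.eq.comp (h 0) (.const r)
  exact Primrec.ite ((he _).or ((he _).or (he _))) (h 1) (Primrec.encode.comp
    (primrec_canon.comp (Primrec.list_cons.comp (h 2) ((Primrec.ofNat _).comp (h 1)))))

theorem encode_canon_cons (A : Sentence) (Γ : Finset Sentence) :
    encode (canon (encF A :: ofNat (List ℕ) (encS Γ))) = encS (Γ ∪ {A}) := by
  rw [← codes, canon_encF_cons, encode_codes]

theorem CGen.endN_eq {c p r : Bool} {a : ℕ} (h : CGen c p r a) : endN a = encS (EndS a) := by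
  cases h <;>
    simp [endN, EndS, proj_tup, axC, andC, orC, omC, exC, cutC, omrepC, decS_encS, decF_encF,
      encode_canon_cons, -Finset.union_singleton]

/-- `y` is the Gödel number of a true literal. -/
def LitTrueN (y : ℕ) : Prop :=
  (y % 6 = 0 ∧ valN (fmlLeft y) = valN (fmlRight y)) ∨
    (y % 6 = 1 ∧ valN (fmlLeft y) ≠ valN (fmlRight y))

theorem primrec_litTrueN : PrimrecPred LitTrueN := by
  have h : PrimrecPred fun y => valN (fmlLeft y) = valN (fmlRight y) :=
    Primrec.eq.comp (primrec_valN.comp primrec_fmlLeft) (primrec_valN.comp primrec_fmlRight)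
  exact ((primrec_mod_eq 6 0).and h).or ((primrec_mod_eq 6 1).and h.not)

theorem litTrueN_enc (A : Fml) :
    LitTrueN A.enc ↔ A.isLiteral = true ∧ A.Sat fun _ => 0 := by
  cases A with
  | eq s t =>
    have h₁ := fmlLeft_pair s.enc t.enc (r := 0) (by omega)
    have h₂ := fmlRight_pair s.enc t.enc (r := 0) (by omega)
    rw [add_zero] at h₁ h₂
    simp [LitTrueN, Fml.enc, Fml.isLiteral, Fml.Sat, h₁, h₂, valN_enc]
  | ne s t =>
    have h₁ := fmlLeft_pair s.enc t.enc (r := 1) (by omega)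
    have h₂ := fmlRight_pair s.enc t.enc (r := 1) (by omega)
    simp [LitTrueN, Fml.enc, Fml.isLiteral, Fml.Sat, h₁, h₂, valN_enc]
  | _ => simp [LitTrueN, Fml.enc, Fml.isLiteral]

theorem exists_litTrueN_codes {Γ : Finset Sentence} :
    (∃ y ∈ codes Γ, LitTrueN y) ↔ IsAxiom Γ := by
  constructor
  · rintro ⟨y, hy, h⟩
    obtain ⟨A, hA, rfl⟩ := mem_codes.1 hy
    rw [encF_eq, litTrueN_enc] at h
    exact ⟨A, hA, h⟩
  · rintro ⟨A, hA, h⟩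
    refine ⟨_, mem_codes.2 ⟨A, hA, rfl⟩, ?_⟩
    rw [encF_eq, litTrueN_enc]
    exact h

/-- The instance `A(n̄)` of a quantified sentence, on Gödel numbers. -/
def instN (x n : ℕ) : ℕ := subFmlN (numeralN n, 0) (fmlLeft x)

theorem primrec_instN : Primrec₂ instN :=
  primrec_subFmlN.comp ((primrec_numeralN.comp .snd).pair (.const 0)) (primrec_fmlLeft.comp .fst)

theorem instN_sAll (A : Fml) (hA : A.cu 1 = true) (n : ℕ) :
    instN (encF (sAll A hA)) n = encF (sInst A hA n) := by
  rw [instN, encF_eq, encF_eq, sAll, Fml.enc, fmlLeft_quant _ (by omega) (by omega), numeralN,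
    subFmlN_enc, sInst]

theorem instN_sEx (A : Fml) (hA : A.cu 1 = true) (n : ℕ) :
    instN (encF (sEx A hA)) n = encF (sInst A hA n) := by
  rw [instN, encF_eq, encF_eq, sEx, Fml.enc, fmlLeft_quant _ (by omega) (by omega), numeralN,
    subFmlN_enc, sInst]

/-- The witness of an instance can be bounded by the Gödel number of the instance. -/
theorem exists_le_sInst_eq (A : Fml) (hA : A.cu 1 = true) (n : ℕ) :
    ∃ m ≤ encF (sInst A hA n), sInst A hA m = sInst A hA n := by
  rcases A.enc_le_enc_sub_or 0 with h | h
  · refine ⟨n, ?_, rfl⟩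
    rw [encF_eq]
    exact (le_numeralN n).trans (h _)
  · exact ⟨0, Nat.zero_le _, Subtype.ext (h _ _)⟩

theorem fmlLeft_sAnd (A B : Sentence) : fmlLeft (encF (sAnd A B)) = encF A := by
  rw [encF_eq, encF_eq, sAnd, Fml.enc, fmlLeft_pair _ _ (by omega)]

theorem fmlRight_sAnd (A B : Sentence) : fmlRight (encF (sAnd A B)) = encF B := by
  rw [encF_eq, encF_eq, sAnd, Fml.enc, fmlRight_pair _ _ (by omega)]

theorem fmlLeft_sOr (A B : Sentence) : fmlLeft (encF (sOr A B)) = encF A := by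
  rw [encF_eq, encF_eq, sOr, Fml.enc, fmlLeft_pair _ _ (by omega)]

theorem fmlRight_sOr (A B : Sentence) : fmlRight (encF (sOr A B)) = encF B := by
  rw [encF_eq, encF_eq, sOr, Fml.enc, fmlRight_pair _ _ (by omega)]

theorem negN_encF (A : Sentence) : negN (encF A) = encF (sNeg A) := by
  rw [encF_eq, encF_eq, sNeg, negN_enc]

/-- The list of Gödel numbers coded by the second component of a local code. -/
def seqN (a : ℕ) : List ℕ := ofNat (List ℕ) (proj a 1)

/-- `a` has the form of an axiom. -/
def AxShape (a : ℕ) : Prop := a = tup [axC, proj a 1] ∧ ∃ y ∈ seqN a, LitTrueN y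

/-- `a` has the form of an `∧`-inference, with matching end sequents of the premises. -/
def AndShape (a : ℕ) : Prop :=
  a = tup [andC, proj a 1, proj a 2, proj a 3, proj a 4] ∧
    endN (proj a 3) = encode (canon (fmlLeft (proj a 2) :: seqN a)) ∧
    endN (proj a 4) = encode (canon (fmlRight (proj a 2) :: seqN a))

/-- `a` has the form of an `∨`-inference, with matching end sequent of the premise. -/
def OrShape (a : ℕ) : Prop :=
  a = tup [orC, proj a 1, proj a 2, proj a 3] ∧
    endN (proj a 3) =
      encode (canon (fmlLeft (proj a 2) :: fmlRight (proj a 2) :: seqN a))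

/-- `a` has the form of an application of the `ω`-rule. -/
def OmShape (a : ℕ) : Prop := a = tup [omC, proj a 1, proj a 2, proj a 3]

/-- `a` has the form of an `∃`-inference, with matching end sequent of the premise. -/
def ExShape (a : ℕ) : Prop :=
  a = tup [exC, proj a 1, proj a 2, proj a 3] ∧
    ∃ n < endN (proj a 3),
      endN (proj a 3) = encode (canon (instN (proj a 2) n :: seqN a))

/-- `a` has the form of a cut, with matching end sequents of the premises. -/
def CutShape (a : ℕ) : Prop :=
  a = tup [cutC, proj a 1, proj a 2, proj a 3, proj a 4] ∧
    endN (proj a 3) = encode (canon (proj a 2 :: seqN a)) ∧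
    endN (proj a 4) = encode (canon (negN (proj a 2) :: seqN a))

/-- A state of the delayed evaluation of the premises of an `ω`-rule.  The components are the
index of the sequence of premises, the main formula, the side formulas, the current sequent, the
number of evaluation steps, and the argument at which the premise is evaluated. -/
abbrev State : Type := ℕ × ℕ × List ℕ × List ℕ × ℕ × ℕ

/-- The application of the `ω`-rule whose premises are computed by `c` at the state `q`. -/
def node (c : Code) (q : State) : ℕ :=
  tup [omC, encode q.2.2.2.1, q.2.1, encode (c.curry (encode q))]

open Classical in
/-- Recursion step of `trans`. -/
noncomputable def transStep (p : Code × List ℕ) (a g h : ℕ) : ℕ :=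
  if canon (seqN a) = seqN a then
    if AxShape a then tup [axC, encode (canon (seqN a ++ p.2))]
    else if AndShape a then tup [andC, encode (canon (seqN a ++ p.2)), proj a 2, g, h]
    else if OrShape a then tup [orC, encode (canon (seqN a ++ p.2)), proj a 2, g]
    else if OmShape a then
      node p.1 (proj a 3, proj a 2, seqN a, canon (proj a 2 :: (seqN a ++ p.2)), 0, 0)
    else if ExShape a then tup [exC, encode (canon (seqN a ++ p.2)), proj a 2, g]
    else if CutShape a then tup [cutC, encode (canon (seqN a ++ p.2)), proj a 2, g, h]
    else 0
  else 0

/-- The translation of a local code, weakened by the sequent `p.2`; the premises of `ω`-rules are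
computed by `p.1`. -/
noncomputable def trans (p : Code × List ℕ) (a : ℕ) : ℕ :=
  treeRec (proj · 3) (proj · 4) (fun p _ => p) 0 transStep p a

/-- The premise number `m` of the application of the `ω`-rule `node c q`: the evaluation of the
premise of the original `ω`-rule is continued by one step. -/
noncomputable def premise (c : Code) (q : State) (m : ℕ) : ℕ :=
  match Code.evaln q.2.2.2.2.1 (ofNat Code q.1)
      (if q.2.2.2.2.1 = 0 then m else q.2.2.2.2.2) with
  | none => node c (q.1, q.2.1, q.2.2.1, canon (instN q.2.1 m :: q.2.2.2.1), q.2.2.2.2.1 + 1,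
      if q.2.2.2.2.1 = 0 then m else q.2.2.2.2.2)
  | some v =>
    if endN v = encode (canon
        (instN q.2.1 (if q.2.2.2.2.1 = 0 then m else q.2.2.2.2.2) :: q.2.2.1)) then
      trans (c, canon (instN q.2.1 m :: q.2.2.2.1)) v
    else 0

theorem primrec_proj_const (i : ℕ) : Primrec fun a => proj a i := primrec_proj.comp .id (.const i)

theorem primrec_seqN : Primrec seqN := (Primrec.ofNat _).comp (primrec_proj_const 1)

theorem primrec_cons {α : Type*} [Primcodable α] {f : α → ℕ} {l : α → List ℕ}
    (hf : Primrec f) (hl : Primrec l) : Primrec fun a => f a :: l a :=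
  Primrec.list_cons.comp hf hl

theorem primrec_canon_cons {α : Type*} [Primcodable α] {f : α → ℕ} {l : α → List ℕ}
    (hf : Primrec f) (hl : Primrec l) : Primrec fun a => canon (f a :: l a) :=
  primrec_canon.comp (Primrec.list_cons.comp hf hl)

theorem primrec_end_eq {i : ℕ} {f : ℕ → ℕ} (hf : Primrec f) :
    PrimrecPred fun a => endN (proj a i) = encode (canon (f a :: seqN a)) :=
  Primrec.eq.comp (primrec_endN.comp (primrec_proj_const i))
    (Primrec.encode.comp (primrec_canon_cons hf primrec_seqN))

theorem primrec_axShape : PrimrecPred AxShape := by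
  have h := primrec_proj_const
  refine .and (Primrec.eq.comp .id (primrec_tup.comp (primrec_cons (.const _)
    (primrec_cons (h 1) (.const []))))) ?_
  exact primrec_litTrueN.exists_mem_list.comp primrec_seqN

theorem primrec_andShape : PrimrecPred AndShape := by
  have h := primrec_proj_const
  refine .and (Primrec.eq.comp .id (primrec_tup.comp (primrec_cons (.const _)
    (primrec_cons (h 1) (primrec_cons (h 2) (primrec_cons (h 3)
      (primrec_cons (h 4) (.const [])))))))) (.and ?_ ?_)
  · exact primrec_end_eq (primrec_fmlLeft.comp (h 2))
  · exact primrec_end_eq (primrec_fmlRight.comp (h 2))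

theorem primrec_shape₃ (r : ℕ) :
    PrimrecPred fun a => a = tup [r, proj a 1, proj a 2, proj a 3] := by
  have h := primrec_proj_const
  exact Primrec.eq.comp .id (primrec_tup.comp (primrec_cons (.const _)
    (primrec_cons (h 1) (primrec_cons (h 2) (primrec_cons (h 3) (.const []))))))

theorem primrec_orShape : PrimrecPred OrShape := by
  have h := primrec_proj_const
  refine .and (primrec_shape₃ _) (Primrec.eq.comp (primrec_endN.comp (h 3))
    (Primrec.encode.comp (primrec_canon_cons (primrec_fmlLeft.comp (h 2))
      (primrec_cons (primrec_fmlRight.comp (h 2)) primrec_seqN))))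

theorem primrec_omShape : PrimrecPred OmShape := primrec_shape₃ _

theorem primrec_exShape : PrimrecPred ExShape := by
  have h := primrec_proj_const
  have hR : PrimrecRel fun n a => endN (proj a 3) =
      encode (canon (instN (proj a 2) n :: seqN a)) :=
    Primrec.eq.comp (primrec_endN.comp ((h 3).comp .snd)) (Primrec.encode.comp
      (primrec_canon_cons (primrec_instN.comp ((h 2).comp .snd) .fst) (primrec_seqN.comp .snd)))
  exact .and (primrec_shape₃ _) (hR.exists_lt.comp (primrec_endN.comp (h 3)) .id)

theorem primrec_cutShape : PrimrecPred CutShape := by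
  have h := primrec_proj_const
  refine .and (Primrec.eq.comp .id (primrec_tup.comp (primrec_cons (.const _)
    (primrec_cons (h 1) (primrec_cons (h 2) (primrec_cons (h 3)
      (primrec_cons (h 4) (.const [])))))))) (.and ?_ ?_)
  · exact primrec_end_eq (h 2)
  · exact primrec_end_eq (primrec_negN.comp (h 2))

theorem primrec_node : Primrec₂ node := by
  have hΔ : Primrec fun p : Code × State => p.2.2.2.2.1 :=
    Primrec.fst.comp (Primrec.snd.comp (Primrec.snd.comp (Primrec.snd.comp .snd)))
  have hx : Primrec fun p : Code × State => p.2.2.1 := Primrec.fst.comp (Primrec.snd.comp .snd)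
  have hc : Primrec fun p : Code × State => encode (p.1.curry (encode p.2)) :=
    Primrec.encode.comp (Code.primrec₂_curry.comp .fst (Primrec.encode.comp .snd))
  exact primrec_tup.comp (primrec_cons (.const _) (primrec_cons (Primrec.encode.comp hΔ)
    (primrec_cons hx (primrec_cons hc (.const [])))))

theorem primrec_trans : Primrec₂ trans := by
  classical
  refine primrec_treeRec 0 (primrec_proj_const 3) (primrec_proj_const 4) Primrec.fst.to₂ ?_
  have hp : Primrec fun z : ((Code × List ℕ) × ℕ) × (ℕ × ℕ) => z.1.1.2 :=
    Primrec.snd.comp (Primrec.fst.comp .fst)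
  have hc : Primrec fun z : ((Code × List ℕ) × ℕ) × (ℕ × ℕ) => z.1.1.1 :=
    Primrec.fst.comp (Primrec.fst.comp .fst)
  have ha : Primrec fun z : ((Code × List ℕ) × ℕ) × (ℕ × ℕ) => z.1.2 := Primrec.snd.comp .fst
  have hg : Primrec fun z : ((Code × List ℕ) × ℕ) × (ℕ × ℕ) => z.2.1 := Primrec.fst.comp .snd
  have hh : Primrec fun z : ((Code × List ℕ) × ℕ) × (ℕ × ℕ) => z.2.2 := Primrec.snd.comp .snd
  have hL := primrec_seqN.comp ha
  have hLp := Primrec.list_append.comp hL hp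
  have hS := Primrec.encode.comp (primrec_canon.comp hLp)
  have hx := (primrec_proj_const 2).comp ha
  have hq := ((primrec_proj_const 3).comp ha).pair <| hx.pair <| hL.pair <|
    (primrec_canon_cons hx hLp).pair ((Primrec.const 0).pair (Primrec.const 0))
  have h₁ (r : ℕ) := primrec_tup.comp (primrec_cons (.const r) (primrec_cons hS
    (primrec_cons hx (primrec_cons hg (.const [])))))
  have h₂ (r : ℕ) := primrec_tup.comp (primrec_cons (.const r) (primrec_cons hS
    (primrec_cons hx (primrec_cons hg (primrec_cons hh (.const []))))))
  refine Primrec.ite (Primrec.eq.comp (primrec_canon.comp hL) hL) ?_ (.const 0)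
  refine Primrec.ite (primrec_axShape.comp ha) (primrec_tup.comp
    (primrec_cons (.const _) (primrec_cons hS (.const [])))) ?_
  refine Primrec.ite (primrec_andShape.comp ha) (h₂ _) ?_
  refine Primrec.ite (primrec_orShape.comp ha) (h₁ _) ?_
  refine Primrec.ite (primrec_omShape.comp ha) (primrec_node.comp hc hq) ?_
  refine Primrec.ite (primrec_exShape.comp ha) (h₁ _) ?_
  exact Primrec.ite (primrec_cutShape.comp ha) (h₂ _) (.const 0)

theorem primrec_premise : Primrec fun z : Code × State × ℕ => premise z.1 z.2.1 z.2.2 := by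
  have hc : Primrec fun z : Code × State × ℕ => z.1 := .fst
  have hm : Primrec fun z : Code × State × ℕ => z.2.2 := Primrec.snd.comp .snd
  have h₁ : Primrec fun z : Code × State × ℕ => z.2.1 := Primrec.fst.comp .snd
  have h₂ := Primrec.snd.comp h₁
  have h₃ := Primrec.snd.comp h₂
  have h₄ := Primrec.snd.comp h₃
  have h₅ := Primrec.snd.comp h₄
  have he := Primrec.fst.comp h₁
  have hx := Primrec.fst.comp h₂
  have hL := Primrec.fst.comp h₃
  have hΔ := Primrec.fst.comp h₄
  have hs := Primrec.fst.comp h₅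
  have hn := Primrec.ite (Primrec.eq.comp hs (.const 0)) hm (Primrec.snd.comp h₅)
  have hΔ' := primrec_canon_cons (primrec_instN.comp hx hm) hΔ
  have ho := Code.primrec_evaln.comp ((hs.pair ((Primrec.ofNat Code).comp he)).pair hn)
  have hnode := primrec_node.comp hc <| he.pair <| hx.pair <| hL.pair <| hΔ'.pair <|
    (Primrec.succ.comp hs).pair hn
  have hS := Primrec.encode.comp (primrec_canon_cons (primrec_instN.comp hx hn) hL)
  have hsome : Primrec₂ fun (z : Code × State × ℕ) (v : ℕ) =>
      if endN v = encode (canon (instN z.2.1.2.1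
        (if z.2.1.2.2.2.2.1 = 0 then z.2.2 else z.2.1.2.2.2.2.2) :: z.2.1.2.2.1)) then
      trans (z.1, canon (instN z.2.1.2.1 z.2.2 :: z.2.1.2.2.2.1)) v else 0 :=
    Primrec.ite (Primrec.eq.comp (primrec_endN.comp .snd) (hS.comp .fst))
      (primrec_trans.comp ((hc.pair hΔ').comp .fst) .snd) (.const 0)
  refine (Primrec.option_casesOn ho hnode hsome).of_eq fun z => ?_
  rw [premise]
  generalize Code.evaln _ _ _ = o
  cases o <;> rfl

theorem exists_code_eval_curry_eq_premise :
    ∃ c : Code, ∀ (q : State) (m : ℕ),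
      peval (encode (c.curry (encode q))) m = Part.some (premise c q m) := by
  have hz : Primrec fun z : Code × ℕ => z.2.unpair := Primrec.unpair.comp .snd
  have hq : Primrec fun z : Code × ℕ => (z.1, ofNat State z.2.unpair.1, z.2.unpair.2) :=
    Primrec.fst.pair (((Primrec.ofNat State).comp (Primrec.fst.comp hz)).pair
      (Primrec.snd.comp hz))
  have hp := primrec_premise.comp hq
  dsimp only at hp
  have h : Computable₂ fun (c : Code) (z : ℕ) =>
      premise c (ofNat State z.unpair.1) z.unpair.2 := hp.to_comp
  obtain ⟨c, hc⟩ := Code.fixed_point₂ h.partrec₂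
  refine ⟨c, fun q m => ?_⟩
  rw [peval, ofNat_encode, Code.eval_curry, hc, PFun.coe_val, Nat.unpair_pair, ofNat_encode]

theorem trans_eq (p : Code × List ℕ) (a : ℕ) :
    trans p a = transStep p a (trans p (proj a 3)) (trans p (proj a 4)) := by
  rcases Nat.eq_zero_or_pos a with rfl | ha
  · obtain ⟨x, y, h⟩ := exists_treeRec_eq (proj · 3) (proj · 4) (fun p _ => p) 0 transStep p 0
    rw [trans, h]
    simp [transStep, AxShape, AndShape, OrShape, OmShape, ExShape, CutShape,
      (tup_ne_zero _).symm]
  · rw [trans, treeRec_of_lt (proj_lt ha 3) (proj_lt ha 4)]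
    rfl

theorem endS_ax (Γ : Finset Sentence) : EndS (tup [axC, encS Γ]) = Γ := by
  simp [EndS, proj_tup, decS_encS]

theorem endS_cut (Γ : Finset Sentence) (x : ℕ) (l : List ℕ) :
    EndS (tup (cutC :: encS Γ :: x :: l)) = Γ := by
  simp [EndS, proj_tup, decS_encS]

theorem endS_rule {r : ℕ} (hr : r = andC ∨ r = orC ∨ r = omC ∨ r = exC) (Γ : Finset Sentence)
    (A : Sentence) (l : List ℕ) : EndS (tup (r :: encS Γ :: encF A :: l)) = Γ ∪ {A} := by
  rcases hr with rfl | rfl | rfl | rfl <;>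
    simp [EndS, proj_tup, decS_encS, decF_encF, axC, andC, orC, omC, exC, cutC, omrepC,
      -Finset.union_singleton]

theorem codes_eq_of_encode_eq {l : List ℕ} {Γ : Finset Sentence} (h : encode l = encS Γ) :
    l = codes Γ := by
  rw [codes, ← h, ofNat_encode]

theorem peval_eq_some_of_evaln {e n s v : ℕ} (h : Code.evaln s (ofNat Code e) n = some v) :
    peval e n = Part.some v :=
  Part.eq_some_iff.2 (Code.evaln_sound h)

theorem CGen.node {ch : Bool} {c : Code} {q : State} {A : Fml} {hA : A.cu 1 = true}
    {Δ : Finset Sentence}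
    (hc : ∀ m, peval (encode (c.curry (encode q))) m = Part.some (premise c q m))
    (hx : q.2.1 = encF (sAll A hA)) (hΔ : q.2.2.2.1 = codes Δ) (hmem : sAll A hA ∈ Δ)
    (h : ∀ m, CGen ch true false (premise c q m) ∧ EndS (premise c q m) = Δ ∪ {sInst A hA m}) :
    CGen ch true false (node c q) ∧ EndS (node c q) = Δ := by
  have hp : Primrec (premise c q) :=
    primrec_premise.comp ((Primrec.const c).pair ((Primrec.const q).pair .id))
  rw [Shoen.node, hx, hΔ, encode_codes]
  refine ⟨.om Δ A hA (fun _ => ⟨_, Primrec.nat_iff.1 hp, hc⟩) (fun n => by simp [hc n])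
    (fun n => ?_) fun n => ?_, ?_⟩
  · simpa only [hc, Part.get_some] using (h n).1
  · simpa only [hc, Part.get_some] using (h n).2
  · rw [endS_rule (by simp), Finset.union_eq_left.2 (Finset.singleton_subset_iff.2 hmem)]

theorem premise_zero (c : Code) (e x n m : ℕ) (L Δ : List ℕ) :
    premise c (e, x, L, Δ, 0, n) m = node c (e, x, L, canon (instN x m :: Δ), 1, m) := by
  simp [premise, Code.evaln]

section Shapes

variable {a g x b d : ℕ} {p : Code × List ℕ}

theorem axShape_of_trans_eq (h : trans p a = tup [axC, g]) :
    canon (seqN a) = seqN a ∧ AxShape a ∧ g = encode (canon (seqN a ++ p.2)) := by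
  rw [trans_eq, transStep] at h
  split_ifs at h <;>
    simp_all [node, tup_injective.eq_iff, (tup_ne_zero _).symm, axC, andC, orC, omC, exC, cutC]

theorem andShape_of_trans_eq (h : trans p a = tup [andC, g, x, b, d]) :
    canon (seqN a) = seqN a ∧ AndShape a ∧ g = encode (canon (seqN a ++ p.2)) ∧ x = proj a 2 ∧
      b = trans p (proj a 3) ∧ d = trans p (proj a 4) := by
  rw [trans_eq, transStep] at h
  split_ifs at h <;>
    simp_all [node, tup_injective.eq_iff, (tup_ne_zero _).symm, axC, andC, orC, omC, exC, cutC]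

theorem orShape_of_trans_eq (h : trans p a = tup [orC, g, x, b]) :
    canon (seqN a) = seqN a ∧ OrShape a ∧ g = encode (canon (seqN a ++ p.2)) ∧ x = proj a 2 ∧
      b = trans p (proj a 3) := by
  rw [trans_eq, transStep] at h
  split_ifs at h <;>
    simp_all [node, tup_injective.eq_iff, (tup_ne_zero _).symm, axC, andC, orC, omC, exC, cutC]

theorem omShape_of_trans_eq (h : trans p a = tup [omC, g, x, b]) :
    canon (seqN a) = seqN a ∧ OmShape a ∧ tup [omC, g, x, b] =
      node p.1 (proj a 3, proj a 2, seqN a, canon (proj a 2 :: (seqN a ++ p.2)), 0, 0) := by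
  rw [← h]
  rw [trans_eq, transStep] at h ⊢
  split_ifs at h ⊢ <;>
    simp_all [node, tup_injective.eq_iff, (tup_ne_zero _).symm, axC, andC, orC, omC, exC, cutC]

theorem exShape_of_trans_eq (h : trans p a = tup [exC, g, x, b]) :
    canon (seqN a) = seqN a ∧ ExShape a ∧ g = encode (canon (seqN a ++ p.2)) ∧ x = proj a 2 ∧
      b = trans p (proj a 3) := by
  rw [trans_eq, transStep] at h
  split_ifs at h <;>
    simp_all [node, tup_injective.eq_iff, (tup_ne_zero _).symm, axC, andC, orC, omC, exC, cutC]

theorem cutShape_of_trans_eq (h : trans p a = tup [cutC, g, x, b, d]) :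
    canon (seqN a) = seqN a ∧ CutShape a ∧ g = encode (canon (seqN a ++ p.2)) ∧ x = proj a 2 ∧
      b = trans p (proj a 3) ∧ d = trans p (proj a 4) := by
  rw [trans_eq, transStep] at h
  split_ifs at h <;>
    simp_all [node, tup_injective.eq_iff, (tup_ne_zero _).symm, axC, andC, orC, omC, exC, cutC]

theorem seqN_tup (r : ℕ) (Γ : Finset Sentence) (l : List ℕ) :
    seqN (tup (r :: encS Γ :: l)) = codes Γ := by
  simp [seqN, proj_tup, codes]

theorem exists_seqN_eq_codes {Γ : Finset Sentence} {l : List ℕ} (hs : canon (seqN a) = seqN a)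
    (h : encS Γ = encode (canon l)) (hl : seqN a ⊆ l) :
    ∃ Γ', seqN a = codes Γ' ∧ proj a 1 = encS Γ' := by
  obtain ⟨Γ', h'⟩ := exists_eq_codes (hs ▸ sortedLT_canon (seqN a)) fun y hy => by
    have hy := mem_canon.2 (hl hy)
    rw [codes_eq_of_encode_eq h.symm, mem_codes] at hy
    exact hy.imp fun _ => And.right
  refine ⟨Γ', h', ?_⟩
  rw [← encode_codes, ← h', seqN, encode_ofNat]

end Shapes

section Trans

variable {a b : ℕ} (c : Code) (Γ Δ : Finset Sentence)

theorem trans_ax (h : IsAxiom Γ) :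
    trans (c, codes Δ) (tup [axC, encS Γ]) = tup [axC, encS (Γ ∪ Δ)] := by
  rw [trans_eq, transStep, seqN_tup, if_pos (canon_eq_self (sortedLT_codes Γ)), if_pos,
    canon_codes_append, encode_codes]
  exact ⟨by simp [proj_tup], by rwa [seqN_tup, exists_litTrueN_codes]⟩

theorem trans_and (A B : Sentence) (ha : endN a = encS (Γ ∪ {A})) (hb : endN b = encS (Γ ∪ {B})) :
    trans (c, codes Δ) (tup [andC, encS Γ, encF (sAnd A B), a, b]) =
      tup [andC, encS (Γ ∪ Δ), encF (sAnd A B), trans (c, codes Δ) a, trans (c, codes Δ) b] := by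
  rw [trans_eq, transStep, seqN_tup, if_pos (canon_eq_self (sortedLT_codes Γ)), if_neg, if_pos,
    canon_codes_append, encode_codes]
  · simp [proj_tup]
  · refine ⟨by simp [proj_tup], ?_⟩
    simp only [proj_tup, seqN_tup]
    simpa [fmlLeft_sAnd, fmlRight_sAnd, canon_encF_cons, encode_codes,
      -Finset.union_singleton] using ⟨ha, hb⟩
  · simp [AxShape, tup_injective.eq_iff]

theorem trans_or (A B : Sentence) (ha : endN a = encS (Γ ∪ {A, B})) :
    trans (c, codes Δ) (tup [orC, encS Γ, encF (sOr A B), a]) =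
      tup [orC, encS (Γ ∪ Δ), encF (sOr A B), trans (c, codes Δ) a] := by
  rw [trans_eq, transStep, seqN_tup, if_pos (canon_eq_self (sortedLT_codes Γ)), if_neg, if_neg,
    if_pos, canon_codes_append, encode_codes]
  · simp [proj_tup]
  · refine ⟨by simp [proj_tup], ?_⟩
    simp only [proj_tup, seqN_tup]
    simpa [fmlLeft_sOr, fmlRight_sOr, canon_encF_cons_cons, encode_codes] using ha
  · simp [AndShape, tup_injective.eq_iff]
  · simp [AxShape, tup_injective.eq_iff]

theorem trans_om (A : Fml) (hA : A.cu 1 = true) (e : ℕ) :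
    trans (c, codes Δ) (tup [omC, encS Γ, encF (sAll A hA), e]) =
      node c (e, encF (sAll A hA), codes Γ, codes (Γ ∪ Δ ∪ {sAll A hA}), 0, 0) := by
  rw [trans_eq, transStep, seqN_tup, if_pos (canon_eq_self (sortedLT_codes Γ)), if_neg, if_neg,
    if_neg, if_pos, ← canon_encF_cons_append]
  · simp [proj_tup]
  · simp [OmShape, proj_tup]
  · simp [OrShape, tup_injective.eq_iff, omC, orC]
  · simp [AndShape, tup_injective.eq_iff]
  · simp [AxShape, tup_injective.eq_iff]

theorem trans_ex (A : Fml) (hA : A.cu 1 = true) (n : ℕ) (ha : endN a = encS (Γ ∪ {sInst A hA n})) :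
    trans (c, codes Δ) (tup [exC, encS Γ, encF (sEx A hA), a]) =
      tup [exC, encS (Γ ∪ Δ), encF (sEx A hA), trans (c, codes Δ) a] := by
  rw [trans_eq, transStep, seqN_tup, if_pos (canon_eq_self (sortedLT_codes Γ)), if_neg, if_neg,
    if_neg, if_neg, if_pos, canon_codes_append, encode_codes]
  · simp [proj_tup]
  · refine ⟨by simp [proj_tup], ?_⟩
    obtain ⟨m, hm, h⟩ := exists_le_sInst_eq A hA n
    simp only [proj_tup, seqN_tup]
    refine ⟨m, ?_, ?_⟩
    · rw [List.getD_cons_succ, List.getD_cons_succ, List.getD_cons_succ, List.getD_cons_zero, ha,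
        ← encode_codes]
      exact hm.trans_lt (lt_encode_of_mem (mem_codes.2 ⟨_, by simp, rfl⟩))
    · simpa [instN_sEx, h, canon_encF_cons, encode_codes, -Finset.union_singleton] using ha
  · simp [OmShape, tup_injective.eq_iff, omC, exC]
  · simp [OrShape, tup_injective.eq_iff, exC, orC]
  · simp [AndShape, tup_injective.eq_iff]
  · simp [AxShape, tup_injective.eq_iff]

theorem trans_cut (C : Sentence) (ha : endN a = encS (Γ ∪ {C}))
    (hb : endN b = encS (Γ ∪ {sNeg C})) :
    trans (c, codes Δ) (tup [cutC, encS Γ, encF C, a, b]) =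
      tup [cutC, encS (Γ ∪ Δ), encF C, trans (c, codes Δ) a, trans (c, codes Δ) b] := by
  rw [trans_eq, transStep, seqN_tup, if_pos (canon_eq_self (sortedLT_codes Γ)), if_neg, if_neg,
    if_neg, if_neg, if_neg, if_pos, canon_codes_append, encode_codes]
  · simp [proj_tup]
  · refine ⟨by simp [proj_tup], ?_⟩
    simp only [proj_tup, seqN_tup]
    simpa [negN_encF, canon_encF_cons, encode_codes, -Finset.union_singleton] using ⟨ha, hb⟩
  · simp [ExShape, tup_injective.eq_iff]
  · simp [OmShape, tup_injective.eq_iff]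
  · simp [OrShape, tup_injective.eq_iff]
  · simp [AndShape, tup_injective.eq_iff, andC, cutC]
  · simp [AxShape, tup_injective.eq_iff]

end Trans

/-- If the premise number `n` of an `ω`-rule is evaluated in finitely many steps to a code whose
translations are correct, then the nodes which delay this evaluation are correct. -/
theorem cgen_node_of_evaln {ch : Bool} {c : Code}
    (hc : ∀ q m, peval (encode (c.curry (encode q))) m = Part.some (premise c q m))
    {Γ : Finset Sentence} {A : Fml} {hA : A.cu 1 = true} {e n S v : ℕ}
    (hS : Code.evaln S (ofNat Code e) n = some v) (hv : endN v = encS (Γ ∪ {sInst A hA n}))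
    (h : ∀ Δ, CGen ch true false (trans (c, codes Δ) v) ∧
      EndS (trans (c, codes Δ) v) = Γ ∪ {sInst A hA n} ∪ Δ) (j : ℕ) :
    ∀ (s : ℕ) (Δ : Finset Sentence), s ≠ 0 → S ≤ s + j → Γ ∪ {sInst A hA n} ⊆ Δ → sAll A hA ∈ Δ →
      CGen ch true false (node c (e, encF (sAll A hA), codes Γ, codes Δ, s, n)) ∧
        EndS (node c (e, encF (sAll A hA), codes Γ, codes Δ, s, n)) = Δ := by
  induction j with
  | zero | succ j ih =>
    intro s Δ hs hj hΓ hΔ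
    refine CGen.node (hc _) rfl rfl hΔ fun m => ?_
    rw [premise]
    simp only [hs, if_false, instN_sAll, canon_encF_cons, encode_codes]
    cases hw : Code.evaln s (ofNat Code e) n with
    | some w =>
      obtain rfl : w = v := Part.some_injective <|
        (peval_eq_some_of_evaln hw).symm.trans (peval_eq_some_of_evaln hS)
      dsimp only
      rw [if_pos hv]
      obtain ⟨h₁, h₂⟩ := h (Δ ∪ {sInst A hA m})
      exact ⟨h₁, by rw [h₂, ← Finset.union_assoc, Finset.union_eq_right.2 hΓ]⟩
    | none =>
      have hlt : s < S := lt_of_not_ge fun hle => by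
        simp [Option.mem_def.1 (Code.evaln_mono hle hS)] at hw
      first
      | omega
      | exact ih _ _ (by omega) (by omega) (hΓ.trans Finset.subset_union_left)
          (Finset.mem_union_left _ hΔ)

/-- The translation of a correct recursive local code, weakened by `Δ`, is a correct primitive
recursive local code. -/
theorem cgen_trans {ch : Bool} {c : Code}
    (hc : ∀ q m, peval (encode (c.curry (encode q))) m = Part.some (premise c q m)) {a : ℕ}
    (h : CGen ch false false a) : ∀ Δ, CGen ch true false (trans (c, codes Δ) a) ∧
      EndS (trans (c, codes Δ) a) = EndS a ∪ Δ := by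
  induction h with
  | ax Γ h =>
    intro Δ
    rw [trans_ax c Γ Δ h, endS_ax, endS_ax]
    exact ⟨.ax _ (h.imp fun A hA => ⟨Finset.mem_union_left _ hA.1, hA.2⟩), rfl⟩
  | and Γ A B ha hb ea eb iha ihb =>
    intro Δ
    rw [trans_and c Γ Δ A B (ea ▸ ha.endN_eq) (eb ▸ hb.endN_eq), endS_rule (by simp),
      endS_rule (by simp)]
    exact ⟨.and _ _ _ (iha Δ).1 (ihb Δ).1
      (by rw [(iha Δ).2, ea, Finset.union_right_comm])
      (by rw [(ihb Δ).2, eb, Finset.union_right_comm]), Finset.union_right_comm ..⟩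
  | or Γ A B ha ea iha =>
    intro Δ
    rw [trans_or c Γ Δ A B (ea ▸ ha.endN_eq), endS_rule (by simp), endS_rule (by simp)]
    exact ⟨.or _ _ _ (iha Δ).1 (by rw [(iha Δ).2, ea, Finset.union_right_comm]),
      Finset.union_right_comm ..⟩
  | @om e Γ A hA hp htot hmem hend ih =>
    intro Δ
    rw [trans_om, endS_rule (by simp), Finset.union_right_comm Γ {_}]
    refine CGen.node (hc _) rfl rfl (by simp) fun m => ?_
    rw [premise_zero, instN_sAll, canon_encF_cons]
    obtain ⟨S, hS⟩ := Code.evaln_complete.1 (Part.get_mem (htot m))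
    refine cgen_node_of_evaln hc hS (hend m ▸ (hmem m).endN_eq) (fun Δ => hend m ▸ ih m Δ) S _ _
      one_ne_zero (by omega) ?_ (by simp)
    intro B hB
    simp only [Finset.mem_union] at hB ⊢
    tauto
  | ex Γ A hA n ha ea iha =>
    intro Δ
    rw [trans_ex c Γ Δ A hA n (ea ▸ ha.endN_eq), endS_rule (by simp), endS_rule (by simp)]
    exact ⟨.ex _ _ _ n (iha Δ).1 (by rw [(iha Δ).2, ea, Finset.union_right_comm]),
      Finset.union_right_comm ..⟩
  | cut hch Γ C ha hb ea eb iha ihb =>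
    intro Δ
    rw [trans_cut c Γ Δ C (ea ▸ ha.endN_eq) (eb ▸ hb.endN_eq), endS_cut, endS_cut]
    exact ⟨.cut hch _ _ (iha Δ).1 (ihb Δ).1
      (by rw [(iha Δ).2, ea, Finset.union_right_comm])
      (by rw [(ihb Δ).2, eb, Finset.union_right_comm]), rfl⟩
  | omrep hr => cases hr

theorem encS_injective : Function.Injective encS := encode_injective

theorem not_cgen_zero {ch p r : Bool} : ¬ CGen ch p r 0 := by
  generalize h : 0 = a
  rintro (_ | _) <;> exact tup_ne_zero _ h.symm

/-- A local code with a correct translation is correct, and the evaluation delayed by a correct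
node terminates with a correct local code. -/
theorem cgen_of_cgen_trans {ch : Bool} {c : Code}
    (hc : ∀ q m, peval (encode (c.curry (encode q))) m = Part.some (premise c q m)) {y : ℕ}
    (h : CGen ch true false y) :
    (∀ a Δ, trans (c, Δ) a = y → CGen ch false false a) ∧
    ∀ e x L Δ s n, s ≠ 0 → node c (e, x, L, Δ, s, n) = y →
      ∃ v, peval e n = Part.some v ∧ CGen ch false false v ∧
        endN v = encode (canon (instN x n :: L)) := by
  induction h with
  | ax Γ h =>
    refine ⟨fun a Δ ht => ?_, fun e x L Δ s n _ hn => ?_⟩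
    · obtain ⟨hs, ⟨ha, hax⟩, hΓ⟩ := axShape_of_trans_eq ht
      obtain ⟨Γ', hL, h₁⟩ := exists_seqN_eq_codes hs hΓ (List.subset_append_left ..)
      rw [ha, h₁]
      exact .ax _ (exists_litTrueN_codes.1 (hL ▸ hax))
    · simp [node, tup_injective.eq_iff] at hn
  | and Γ A B ha hb ea eb iha ihb =>
    refine ⟨fun a Δ ht => ?_, fun e x L Δ s n _ hn => ?_⟩
    · obtain ⟨hs, ⟨ha, h₃, h₄⟩, hΓ, hx, hb, hd⟩ := andShape_of_trans_eq ht
      obtain ⟨Γ', hL, h₁⟩ := exists_seqN_eq_codes hs hΓ (List.subset_append_left ..)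
      have iha := iha.1 _ _ hb.symm
      have ihb := ihb.1 _ _ hd.symm
      rw [← hx, hL, iha.endN_eq, fmlLeft_sAnd, canon_encF_cons, encode_codes] at h₃
      rw [← hx, hL, ihb.endN_eq, fmlRight_sAnd, canon_encF_cons, encode_codes] at h₄
      rw [ha, h₁, ← hx]
      exact .and _ _ _ iha ihb (encS_injective h₃) (encS_injective h₄)
    · simp [node, tup_injective.eq_iff] at hn
  | or Γ A B ha ea iha =>
    refine ⟨fun a Δ ht => ?_, fun e x L Δ s n _ hn => ?_⟩
    · obtain ⟨hs, ⟨ha, h₃⟩, hΓ, hx, hb⟩ := orShape_of_trans_eq ht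
      obtain ⟨Γ', hL, h₁⟩ := exists_seqN_eq_codes hs hΓ (List.subset_append_left ..)
      have iha := iha.1 _ _ hb.symm
      rw [← hx, hL, iha.endN_eq, fmlLeft_sOr, fmlRight_sOr, canon_encF_cons_cons,
        encode_codes] at h₃
      rw [ha, h₁, ← hx]
      exact .or _ _ _ iha (encS_injective h₃)
    · simp [node, tup_injective.eq_iff, omC, orC] at hn
  | @om e' Γ A hA hp htot hmem hend ih =>
    have hget (q : State) (hq : e' = encode (c.curry (encode q))) (m : ℕ) :
        (peval e' m).get (htot m) = premise c q m := by
      simp only [hq, hc, Part.get_some]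
    refine ⟨fun a Δ ht => ?_, fun e x L Δ s n hs hn => ?_⟩
    · obtain ⟨hs, ha, hn⟩ := omShape_of_trans_eq ht
      simp only [node, tup_injective.eq_iff, List.cons.injEq, true_and, and_true] at hn
      obtain ⟨hΓ, hx, hq⟩ := hn
      obtain ⟨Γ', hL, h₁⟩ := exists_seqN_eq_codes hs hΓ fun y hy => by simp [hy]
      have hv (m : ℕ) := (ih m).2 _ _ _ _ _ _ one_ne_zero
        ((hget _ hq m).trans (premise_zero ..)).symm
      choose v hv hvC hvE using hv
      have hE (m : ℕ) : EndS (v m) = Γ' ∪ {sInst A hA m} := encS_injective <| by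
        rw [← (hvC m).endN_eq, hvE, ← hx, hL, instN_sAll, canon_encF_cons, encode_codes]
      rw [ha, h₁, ← hx]
      refine .om _ _ _ (by simp) (fun m => by simp [hv]) (fun m => ?_) fun m => ?_
      · simpa only [hv, Part.get_some] using hvC m
      · simpa only [hv, Part.get_some] using hE m
    · simp only [node, tup_injective.eq_iff, List.cons.injEq, true_and, and_true] at hn
      have hy := hget _ hn.2.2.symm 0
      have hC := hmem 0
      have ih := ih 0
      rw [hy] at hC ih
      simp only [premise, hs, if_false] at hC ih
      cases hw : Code.evaln s (ofNat Code e) n with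
      | none =>
        rw [hw] at ih
        exact ih.2 _ _ _ _ _ _ s.succ_ne_zero rfl
      | some v =>
        rw [hw] at ih hC
        dsimp only at ih hC
        split_ifs at ih hC with hE
        · exact ⟨v, peval_eq_some_of_evaln hw, ih.1 _ _ rfl, hE⟩
        · exact absurd hC not_cgen_zero
  | ex Γ A hA n ha ea iha =>
    refine ⟨fun a Δ ht => ?_, fun e x L Δ s n _ hn => ?_⟩
    · obtain ⟨hs, ⟨ha, m, -, h₃⟩, hΓ, hx, hb⟩ := exShape_of_trans_eq ht
      obtain ⟨Γ', hL, h₁⟩ := exists_seqN_eq_codes hs hΓ (List.subset_append_left ..)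
      have iha := iha.1 _ _ hb.symm
      rw [← hx, hL, iha.endN_eq, instN_sEx, canon_encF_cons, encode_codes] at h₃
      rw [ha, h₁, ← hx]
      exact .ex _ _ _ m iha (encS_injective h₃)
    · simp [node, tup_injective.eq_iff, omC, exC] at hn
  | cut hch Γ C ha hb ea eb iha ihb =>
    refine ⟨fun a Δ ht => ?_, fun e x L Δ s n _ hn => ?_⟩
    · obtain ⟨hs, ⟨ha, h₃, h₄⟩, hΓ, hx, hb, hd⟩ := cutShape_of_trans_eq ht
      obtain ⟨Γ', hL, h₁⟩ := exists_seqN_eq_codes hs hΓ (List.subset_append_left ..)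
      have iha := iha.1 _ _ hb.symm
      have ihb := ihb.1 _ _ hd.symm
      rw [← hx, hL, iha.endN_eq, canon_encF_cons, encode_codes] at h₃
      rw [← hx, hL, ihb.endN_eq, negN_encF, canon_encF_cons, encode_codes] at h₄
      rw [ha, h₁, ← hx]
      exact .cut hch _ _ iha ihb (encS_injective h₃) (encS_injective h₄)
    · simp [node, tup_injective.eq_iff] at hn
  | omrep hr => cases hr

/-- There is a primitive recursive translation of recursive into primitive recursive local codes
which preserves the end sequent. -/
theorem exists_primrec_translation :
    ∃ f : ℕ → ℕ, Nat.Primrec f ∧ ∀ (ch : Bool) (a : ℕ),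
      (CGen ch false false a ↔ CGen ch true false (f a)) ∧
        (CGen ch false false a → EndS a = EndS (f a)) := by
  obtain ⟨c, hc⟩ := exists_code_eval_curry_eq_premise
  refine ⟨trans (c, codes ∅), Primrec.nat_iff.1 (primrec_trans.comp (.const _) .id), fun ch a =>
    ⟨⟨fun h => (cgen_trans hc h ∅).1, fun h => (cgen_of_cgen_trans hc h).1 a _ rfl⟩,
      fun h => ?_⟩⟩
  rw [(cgen_trans hc h ∅).2, Finset.union_empty]

end Translation

/-- **Reduction of recursive to primitive recursive local codes.**  There is a
primitive recursive `f` with `a ∈ C_rec ↔ f(a) ∈ C_prec`,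
`a ∈ C_rec^- ↔ f(a) ∈ C_prec^-`, and `End(a) = End(f(a))` for `a ∈ C_rec`. -/
theorem crec_to_cprec :
    ∃ f : ℕ → ℕ, Nat.Primrec f ∧
      (∀ a : ℕ, Crec a ↔ Cprec (f a)) ∧
      (∀ a : ℕ, CrecM a ↔ CprecM (f a)) ∧
      (∀ a : ℕ, Crec a → EndS a = EndS (f a)) := by
  obtain ⟨f, hf, h⟩ := exists_primrec_translation
  exact ⟨f, hf, fun a => (h true a).1, fun a => (h false a).1, fun a => (h true a).2⟩

end Shoen
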